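/- arXiv:0808.2521 — 4 statements merged into one kernel-verified Lean document; each statement's English description precedes it below -/
import Mathlib

section
/- The spectral gap (Poincaré constant) of the random transpositions walk on S_n is 2/n: for every function f : S_n → ℝ, (2/n)·Var_μ(f) ≤ (1/2) Σ_{π,π'} (f(π)-f(π'))² Π(π,π') μ({π}), and 2/n is the largest constant for which this holds for all f. -/
open scoped Classical
open Matrix Finset

/-- The random transpositions transition kernel on the symmetric group. -/
noncomputable def rtKernel (n : ℕ) (p p' : Equiv.Perm (Fin n)) : ℝ :=
  if p' = p then 1 / n
  else if ∃ τ : Equiv.Perm (Fin n), τ.IsSwap ∧ p' = p * τ then 2 / (n : ℝ) ^ 2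
  else 0

/-- Mean of `f` under the uniform distribution on `S_n`. -/
noncomputable def unifMean (n : ℕ) (f : Equiv.Perm (Fin n) → ℝ) : ℝ :=
  (∑ p : Equiv.Perm (Fin n), f p) / Fintype.card (Equiv.Perm (Fin n))

/-- Variance of `f` under the uniform distribution on `S_n`. -/
noncomputable def unifVar (n : ℕ) (f : Equiv.Perm (Fin n) → ℝ) : ℝ :=
  (∑ p : Equiv.Perm (Fin n), (f p - unifMean n f) ^ 2) / Fintype.card (Equiv.Perm (Fin n))

/-- Dirichlet form of the random transpositions walk under the uniform distribution. -/
noncomputable def rtDirichlet (n : ℕ) (f : Equiv.Perm (Fin n) → ℝ) : ℝ :=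
  (1 / 2) * ∑ p : Equiv.Perm (Fin n), ∑ p' : Equiv.Perm (Fin n),
    (f p - f p') ^ 2 * rtKernel n p p' * (1 / (Fintype.card (Equiv.Perm (Fin n)) : ℝ))

namespace RandomTranspositions

open Equiv

/-- The sum of the differences of `f` at `p` over ordered pairs of positions. -/
noncomputable def lap {α : Type} [Fintype α] [DecidableEq α] (f : Perm α → ℝ) (p : Perm α) : ℝ :=
  ∑ i, ∑ j, (f p - f (p * Equiv.swap i j))

/-- The unnormalized Dirichlet form, summed over ordered pairs of positions. -/
noncomputable def energy {α : Type} [Fintype α] [DecidableEq α] (f : Perm α → ℝ) : ℝ :=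
  ∑ p, ∑ i, ∑ j, (f p - f (p * Equiv.swap i j)) ^ 2

section

variable {α : Type} [Fintype α] [DecidableEq α]

theorem sum_mul_swap (g : Perm α → ℝ) (i j : α) : ∑ p, g (p * Equiv.swap i j) = ∑ p, g p :=
  Equiv.sum_comp (Equiv.mulRight (Equiv.swap i j)) g

theorem sum_lap (f : Perm α → ℝ) : ∑ p, lap f p = 0 := by
  simp only [lap]
  rw [Finset.sum_comm]
  refine Finset.sum_eq_zero fun i _ => ?_
  rw [Finset.sum_comm]
  refine Finset.sum_eq_zero fun j _ => ?_
  rw [Finset.sum_sub_distrib, sum_mul_swap, sub_self]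

theorem two_mul_sum_mul_lap (a b : Perm α → ℝ) :
    2 * ∑ p, b p * lap a p =
      ∑ p, ∑ i, ∑ j, (a p - a (p * Equiv.swap i j)) * (b p - b (p * Equiv.swap i j)) := by
  have hcomm : ∀ F : Perm α → α → α → ℝ,
      ∑ p, ∑ i, ∑ j, F p i j = ∑ i, ∑ j, ∑ p, F p i j := fun F => by
    rw [Finset.sum_comm]
    exact Finset.sum_congr rfl fun i _ => Finset.sum_comm
  simp only [lap, Finset.mul_sum]
  rw [hcomm, hcomm]
  refine Finset.sum_congr rfl fun i _ => Finset.sum_congr rfl fun j _ => ?_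
  have h := sum_mul_swap (fun p => (a p - a (p * Equiv.swap i j)) * b (p * Equiv.swap i j)) i j
  simp only [mul_assoc, Equiv.swap_mul_self, mul_one] at h
  simp only [mul_sub, Finset.sum_sub_distrib, ← Finset.mul_sum]
  simp only [sub_mul, Finset.sum_sub_distrib] at h ⊢
  have h2 := sum_mul_swap (fun p => a p * b p) i j
  have e1 : ∑ x, b x * a x = ∑ x, a x * b x := Finset.sum_congr rfl fun x _ => mul_comm _ _
  have e2 : ∑ x, b x * a (x * Equiv.swap i j) = ∑ x, a (x * Equiv.swap i j) * b x :=
    Finset.sum_congr rfl fun x _ => mul_comm _ _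
  rw [e1, e2]
  linarith

theorem sum_mul_lap_comm (a b : Perm α → ℝ) : ∑ p, b p * lap a p = ∑ p, a p * lap b p := by
  have h1 := two_mul_sum_mul_lap a b
  have h2 := two_mul_sum_mul_lap b a
  simp only [mul_comm (b _ - _)] at h2
  linarith

theorem energy_eq (f : Perm α → ℝ) : energy f = 2 * ∑ p, f p * lap f p := by
  rw [two_mul_sum_mul_lap]
  simp only [energy, sq]

theorem energy_nonneg (f : Perm α → ℝ) : 0 ≤ energy f :=
  Finset.sum_nonneg fun _ _ => Finset.sum_nonneg fun _ _ => Finset.sum_nonneg fun _ _ =>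
    sq_nonneg _

theorem lap_add (a b : Perm α → ℝ) (p : Perm α) :
    lap (fun q => a q + b q) p = lap a p + lap b p := by
  simp only [lap, ← Finset.sum_add_distrib]
  refine Finset.sum_congr rfl fun i _ => Finset.sum_congr rfl fun j _ => by ring

theorem lap_const_mul (c : ℝ) (a : Perm α → ℝ) (p : Perm α) :
    lap (fun q => c * a q) p = c * lap a p := by
  simp only [lap, Finset.mul_sum, mul_sub]

/-- A function of a single coordinate `p k` is an eigenfunction of `lap`, up to constants. -/
theorem lap_apply_coord (g : α → ℝ) (k : α) (p : Perm α) :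
    lap (fun q => g (q k)) p = 2 * Fintype.card α * g (p k) - 2 * ∑ m, g m := by
  have hrow : ∀ i, ∑ j, (g (p k) - g ((p * Equiv.swap i j) k)) =
      (if i = k then Fintype.card α * g (p k) - ∑ m, g m else 0) + (g (p k) - g (p i)) := by
    intro i
    by_cases hi : i = k
    · subst hi
      simp [Finset.sum_sub_distrib, Equiv.sum_comp p g]
    · rw [Finset.sum_eq_single k]
      · simp [hi]
      · intro j _ hj
        rw [Perm.mul_apply, Equiv.swap_apply_of_ne_of_ne (Ne.symm hi) (Ne.symm hj), sub_self]
      · simp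
  simp only [lap, hrow, Finset.sum_add_distrib, Finset.sum_sub_distrib, Equiv.sum_comp p g]
  simp
  ring

/-- If `lap v` equals `2 n v` up to a constant and `v` sums to zero, the constant vanishes. -/
theorem lap_eq_of_sum_eq_zero {v : Perm α → ℝ} {b c : ℝ} (h : ∀ p, lap v p = b * v p - c)
    (h0 : ∑ p, v p = 0) (p : Perm α) : lap v p = b * v p := by
  have hs := sum_lap v
  simp only [h, Finset.sum_sub_distrib, ← Finset.mul_sum, h0] at hs
  have : c = 0 := by simpa [Fintype.card_ne_zero] using hs
  simp [h, this]

/-- Summing over the coset of the stabilizer of `k`. -/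
theorem sum_mul_ofSubtype (w : Perm α → ℝ) (k : α) (p : Perm α) :
    ∑ σ : Perm {x // x ≠ k}, w (p * Perm.ofSubtype σ) =
      ∑ q, if q k = p k then w q else 0 := by
  rw [← Finset.sum_filter]
  refine Finset.sum_bij (fun σ _ => p * Perm.ofSubtype σ) ?_ ?_ ?_ ?_
  · intro σ _
    simp [Perm.ofSubtype_apply_of_not_mem]
  · intro σ _ σ' _ h
    exact Perm.ofSubtype_injective (mul_left_cancel h)
  · intro q hq
    simp only [Finset.mem_filter, Finset.mem_univ, true_and] at hq
    have hk : (p⁻¹ * q) k = k := by simp [Perm.mul_apply, hq]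
    refine ⟨(p⁻¹ * q).subtypePerm (p := fun x => x ≠ k) ?_, Finset.mem_univ _, ?_⟩
    · intro x
      rw [not_iff_not]
      nth_rewrite 1 [← hk]
      exact (p⁻¹ * q).injective.eq_iff
    · rw [Perm.ofSubtype_subtypePerm]
      · simp
      · rintro x hx rfl
        exact hx hk
  · intros; rfl

theorem sum_coset (F : Perm α → ℝ) (k : α) :
    ∑ p, ∑ σ : Perm {x // x ≠ k}, F (p * Perm.ofSubtype σ) =
      Fintype.card (Perm {x // x ≠ k}) * ∑ p, F p := by
  rw [Finset.sum_comm]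
  have : ∀ σ : Perm {x // x ≠ k}, ∑ p, F (p * Perm.ofSubtype σ) = ∑ p, F p := fun σ =>
    Equiv.sum_comp (Equiv.mulRight (Perm.ofSubtype σ)) F
  simp [this]

/-- A Poincaré inequality on the stabilizer of `k` lifts to functions averaging to zero on
every coset of it. -/
theorem poincare_stabilizer {c : ℝ} (k : α) (w : Perm α → ℝ)
    (ih : ∀ f : Perm {x // x ≠ k} → ℝ, ∑ p, f p = 0 → c * ∑ p, f p ^ 2 ≤ energy f)
    (hw : ∀ m, ∑ q, (if q k = m then w q else 0) = 0) :
    c * ∑ p, w p ^ 2 ≤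
      ∑ p, ∑ i : {x // x ≠ k}, ∑ j : {x // x ≠ k}, (w p - w (p * Equiv.swap (i : α) j)) ^ 2 := by
  have h : ∀ p : Perm α, c * ∑ σ : Perm {x // x ≠ k}, w (p * Perm.ofSubtype σ) ^ 2 ≤
      ∑ σ : Perm {x // x ≠ k}, ∑ i : {x // x ≠ k}, ∑ j : {x // x ≠ k},
        (w (p * Perm.ofSubtype σ) - w (p * Perm.ofSubtype σ * Equiv.swap (i : α) j)) ^ 2 := by
    intro p
    have := ih (fun σ => w (p * Perm.ofSubtype σ)) (by rw [sum_mul_ofSubtype, hw])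
    simpa only [energy, map_mul, Perm.ofSubtype_swap_eq, mul_assoc] using this
  have hs := Finset.sum_le_sum fun p (_ : p ∈ Finset.univ) => h p
  rw [← Finset.mul_sum, sum_coset (fun q => w q ^ 2) k,
    sum_coset (fun q => ∑ i : {x // x ≠ k}, ∑ j : {x // x ≠ k},
      (w q - w (q * Equiv.swap (i : α) j)) ^ 2) k] at hs
  have hpos : (0 : ℝ) < Fintype.card (Perm {x // x ≠ k}) := by exact_mod_cast Fintype.card_pos
  refine le_of_mul_le_mul_left ?_ hpos
  linarith

theorem sum_sum_ne (F : α → α → ℝ) (hF : ∀ i, F i i = 0) :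
    ∑ k : α, ∑ i : {x // x ≠ k}, ∑ j : {x // x ≠ k}, F i j =
      (Fintype.card α - 2) * ∑ i, ∑ j, F i j := by
  have h : ∀ k, ∑ i : {x // x ≠ k}, ∑ j : {x // x ≠ k}, F i j =
      ∑ i, ∑ j, F i j - ∑ j, F k j - ∑ i, F i k := by
    intro k
    have hsub : ∀ G : α → ℝ, ∑ i : {x // x ≠ k}, G i = ∑ i, G i - G k := fun G => by
      have := Fintype.sum_eq_add_sum_subtype_ne G k
      linarith
    rw [hsub fun i => ∑ j : {x // x ≠ k}, F i j]
    simp only [hsub, Finset.sum_sub_distrib, hF]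
    ring
  simp only [h, Finset.sum_sub_distrib]
  rw [Finset.sum_comm (f := fun k i => F i k)]
  simp
  ring

theorem exists_decomposition (f : Perm α → ℝ) :
    ∃ v w : Perm α → ℝ, (∀ p, f p = v p + w p) ∧ ∑ p, v p * w p = 0 ∧
      (∀ k m, ∑ q, (if q k = m then w q else 0) = 0) ∧
      ∃ c, ∀ p, lap v p = 2 * Fintype.card α * v p - c := by
  let e : α × α → EuclideanSpace ℝ (Perm α) :=
    fun x => WithLp.toLp 2 fun q => if q x.1 = x.2 then 1 else 0
  obtain ⟨v, hv, w, hw, hvw⟩ :=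
    (Submodule.span ℝ (Set.range e)).exists_add_mem_mem_orthogonal (WithLp.toLp 2 f)
  refine ⟨fun p => v p, fun p => w p, fun p => ?_, ?_, fun k m => ?_, ?_⟩
  · simpa using congrArg (fun u : EuclideanSpace ℝ (Perm α) => u p) hvw
  · have := (Submodule.mem_orthogonal _ _).1 hw v hv
    simpa [PiLp.inner_apply, mul_comm] using this
  · have := (Submodule.mem_orthogonal _ _).1 hw (e (k, m)) (Submodule.subset_span ⟨_, rfl⟩)
    simpa [PiLp.inner_apply, e] using this
  · clear hw hvw
    induction hv using Submodule.span_induction with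
    | mem x hx =>
      obtain ⟨⟨k, m⟩, rfl⟩ := hx
      exact ⟨_, lap_apply_coord (fun y => if y = m then 1 else 0) k⟩
    | zero => exact ⟨0, fun p => by simp [lap]⟩
    | add x y _ _ hx hy =>
      obtain ⟨c, hc⟩ := hx
      obtain ⟨d, hd⟩ := hy
      refine ⟨c + d, fun p => ?_⟩
      simp only [PiLp.add_apply]
      rw [lap_add (fun q => x q) (fun q => y q), hc, hd]
      ring
    | smul a x _ hx =>
      obtain ⟨c, hc⟩ := hx
      refine ⟨a * c, fun p => ?_⟩
      simp only [PiLp.smul_apply, smul_eq_mul]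
      rw [lap_const_mul a (fun q => x q), hc]
      ring

theorem energy_eq_of_lap_eq {v : Perm α → ℝ} {b : ℝ} (h : ∀ p, lap v p = b * v p) :
    energy v = 2 * b * ∑ p, v p ^ 2 := by
  simp only [energy_eq, h, Finset.mul_sum]
  exact Finset.sum_congr rfl fun p _ => by ring

theorem energy_add_of_lap_eq {v w : Perm α → ℝ} {b : ℝ} (h : ∀ p, lap v p = b * v p)
    (hvw : ∑ p, v p * w p = 0) :
    energy (fun p => v p + w p) = energy v + energy w := by
  have h1 : ∑ p, w p * lap v p = 0 := by
    have : ∑ p, w p * lap v p = b * ∑ p, v p * w p := by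
      rw [Finset.mul_sum]
      exact Finset.sum_congr rfl fun p _ => by rw [h]; ring
    rw [this, hvw, mul_zero]
  have h2 := sum_mul_lap_comm v w
  simp only [energy_eq, lap_add, mul_add, add_mul, Finset.sum_add_distrib]
  linarith

end

/-- The Poincaré inequality for random transpositions, for functions summing to zero. -/
theorem poincare : ∀ (n : ℕ) (α : Type) [Fintype α] [DecidableEq α], Fintype.card α = n →
    ∀ f : Perm α → ℝ, ∑ p, f p = 0 → 4 * (n : ℝ) * ∑ p, f p ^ 2 ≤ energy f := by
  intro n
  induction n with
  | zero =>
    intro α _ _ _ f _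
    simpa using energy_nonneg f
  | succ n ih =>
    intro α _ _ hα f hf
    rcases Nat.eq_zero_or_pos n with rfl | hn
    · have : Subsingleton α := Fintype.card_le_one_iff_subsingleton.1 hα.le
      have h1 : ∀ p, f p = 0 := fun p => by
        rwa [Fintype.sum_subsingleton f p] at hf
      simpa [h1] using energy_nonneg f
    · obtain ⟨v, w, hfvw, hvw, hw, c, hc⟩ := exists_decomposition f
      have hne : Nonempty α := Fintype.card_pos_iff.1 (by omega)
      have hwsum : ∑ p, w p = 0 := by
        obtain ⟨k⟩ := hne
        have := Finset.sum_eq_zero fun m (_ : m ∈ Finset.univ) => hw k m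
        rw [Finset.sum_comm] at this
        simpa using this
      have hvsum : ∑ p, v p = 0 := by
        simp only [hfvw, Finset.sum_add_distrib] at hf
        linarith
      have hlap := lap_eq_of_sum_eq_zero hc hvsum
      have hcard : ∀ k : α, Fintype.card {x // x ≠ k} = n := fun k => by
        rw [Fintype.card_subtype_compl, Fintype.card_subtype_eq, hα, Nat.add_sub_cancel]
      have hk := Finset.sum_le_sum fun k (_ : k ∈ Finset.univ) =>
        poincare_stabilizer k w (ih {x // x ≠ k} (hcard k)) (hw k)
      rw [Finset.sum_comm] at hk
      have hpair : ∀ p, ∑ k : α, ∑ i : {x // x ≠ k}, ∑ j : {x // x ≠ k},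
          (w p - w (p * Equiv.swap (i : α) j)) ^ 2 =
          (Fintype.card α - 2) * ∑ i, ∑ j, (w p - w (p * Equiv.swap i j)) ^ 2 := fun p =>
        sum_sum_ne (fun i j => (w p - w (p * Equiv.swap i j)) ^ 2) fun i => by
          rw [Equiv.swap_self, ← Perm.one_def, mul_one, sub_self, sq, mul_zero]
      rw [Finset.sum_congr rfl fun p _ => hpair p, Finset.sum_const, ← Finset.mul_sum] at hk
      change _ ≤ _ * energy w at hk
      simp only [Finset.card_univ, hα, nsmul_eq_mul] at hk
      have hW : 0 ≤ ∑ p, w p ^ 2 := Finset.sum_nonneg fun p _ => sq_nonneg _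
      have hwE : 4 * ((n + 1 : ℕ) : ℝ) * ∑ p, w p ^ 2 ≤ energy w := by
        have hn' : (1 : ℝ) ≤ n := by exact_mod_cast hn
        push_cast at hk ⊢
        rcases hn'.eq_or_lt with h1 | h1
        · rw [← h1] at hk ⊢
          have := energy_nonneg w
          linarith
        · refine le_of_mul_le_mul_left ?_ (sub_pos.2 h1)
          have : 0 ≤ 4 * ((n : ℝ) + 1) * ∑ p, w p ^ 2 := by positivity
          linarith
      have hfE : f = fun p => v p + w p := funext hfvw
      have hsq : ∑ p, f p ^ 2 = ∑ p, v p ^ 2 + ∑ p, w p ^ 2 := by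
        have : ∑ p, f p ^ 2 = ∑ p, v p ^ 2 + 2 * ∑ p, v p * w p + ∑ p, w p ^ 2 := by
          rw [Finset.mul_sum, ← Finset.sum_add_distrib, ← Finset.sum_add_distrib]
          exact Finset.sum_congr rfl fun p _ => by rw [hfvw]; ring
        rw [this, hvw]; ring
      rw [hsq, hfE, energy_add_of_lap_eq hlap hvw, energy_eq_of_lap_eq hlap, hα]
      linarith

theorem swap_eq_swap {α : Type} [DecidableEq α] {a b i j : α} (hab : a ≠ b) (h : Equiv.swap i j = Equiv.swap a b) :
    (i = a ∧ j = b) ∨ (i = b ∧ j = a) := by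
  have ha := congrArg (fun e : Perm α => e a) h
  have hb := congrArg (fun e : Perm α => e b) h
  simp only [Equiv.swap_apply_def] at ha hb
  grind

theorem sum_swap {α : Type} [Fintype α] [DecidableEq α] (h : Perm α → ℝ) (h1 : h 1 = 0) :
    ∑ i, ∑ j, h (Equiv.swap i j) = 2 * ∑ τ : Perm α, if τ.IsSwap then h τ else 0 := by
  rw [← Fintype.sum_prod_type' (fun i j => h (Equiv.swap i j)),
    ← Finset.sum_fiberwise Finset.univ (fun x : α × α => Equiv.swap x.1 x.2), Finset.mul_sum]
  refine Finset.sum_congr rfl fun τ _ => ?_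
  have hτ : ∀ x ∈ Finset.univ.filter (fun x : α × α => Equiv.swap x.1 x.2 = τ),
      h (Equiv.swap x.1 x.2) = h τ := fun x hx => by rw [(Finset.mem_filter.1 hx).2]
  rw [Finset.sum_congr rfl hτ, Finset.sum_const, nsmul_eq_mul]
  by_cases hs : τ.IsSwap
  · obtain ⟨a, b, hab, rfl⟩ := id hs
    have : Finset.univ.filter (fun x : α × α => Equiv.swap x.1 x.2 = Equiv.swap a b) = {(a, b), (b, a)} := by
      ext ⟨i, j⟩
      simp only [Finset.mem_filter, Finset.mem_univ, true_and, Finset.mem_insert,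
        Finset.mem_singleton, Prod.mk.injEq]
      refine ⟨swap_eq_swap hab, ?_⟩
      rintro (⟨rfl, rfl⟩ | ⟨rfl, rfl⟩)
      · rfl
      · exact Equiv.swap_comm _ _
    rw [this, Finset.card_pair (by simp [hab]), if_pos hs]
    norm_num
  · rw [if_neg hs]
    by_cases h0 : τ = 1
    · simp [h0, h1]
    · rw [Finset.filter_false_of_mem]
      · simp
      · rintro ⟨i, j⟩ _ rfl
        exact hs ⟨i, j, fun hij => h0 (by rw [hij, Equiv.swap_self, Perm.one_def]), rfl⟩

theorem rtDirichlet_eq (n : ℕ) (f : Perm (Fin n) → ℝ) :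
    rtDirichlet n f =
      energy f / (2 * (n : ℝ) ^ 2 * Fintype.card (Perm (Fin n))) := by
  have h : ∀ p, ∑ p', (f p - f p') ^ 2 * rtKernel n p p' *
      (1 / (Fintype.card (Perm (Fin n)) : ℝ)) =
      (∑ i, ∑ j, (f p - f (p * Equiv.swap i j)) ^ 2) *
        (1 / ((n : ℝ) ^ 2 * Fintype.card (Perm (Fin n)))) := by
    intro p
    rw [sum_swap (fun τ => (f p - f (p * τ)) ^ 2) (by simp), Finset.mul_sum, Finset.sum_mul,
      ← Equiv.sum_comp (Equiv.mulLeft p)]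
    refine Finset.sum_congr rfl fun τ _ => ?_
    simp only [Equiv.coe_mulLeft, rtKernel, mul_eq_left, mul_right_inj]
    by_cases h0 : τ = 1
    · simp [h0]
    · have : (∃ τ' : Perm (Fin n), τ'.IsSwap ∧ τ = τ') ↔ τ.IsSwap := by simp
      simp only [h0, this, if_false]
      split_ifs
      · simp only [one_div, mul_inv]; ring
      · simp
  simp only [rtDirichlet, h, ← Finset.sum_mul, energy]
  simp only [mul_inv, div_eq_mul_inv]
  ring

theorem sum_sub_unifMean (n : ℕ) (f : Perm (Fin n) → ℝ) : ∑ p, (f p - unifMean n f) = 0 := by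
  have : (Fintype.card (Perm (Fin n)) : ℝ) ≠ 0 := Nat.cast_ne_zero.2 Fintype.card_ne_zero
  rw [Finset.sum_sub_distrib, Finset.sum_const, Finset.card_univ, nsmul_eq_mul, unifMean,
    mul_div_cancel₀ _ this, sub_self]

theorem two_div_mul_unifVar_eq (n : ℕ) (hn : 2 ≤ n) (f : Perm (Fin n) → ℝ) :
    2 / n * unifVar n f = 4 * n * (∑ p, (f p - unifMean n f) ^ 2) /
      (2 * (n : ℝ) ^ 2 * Fintype.card (Perm (Fin n))) := by
  have : (n : ℝ) ≠ 0 := by positivity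
  have : (Fintype.card (Perm (Fin n)) : ℝ) ≠ 0 := Nat.cast_ne_zero.2 Fintype.card_ne_zero
  rw [unifVar]
  field_simp
  ring

theorem energy_sub_const {α : Type} [Fintype α] [DecidableEq α] (f : Perm α → ℝ) (c : ℝ) :
    energy (fun p => f p - c) = energy f := by
  simp only [energy, sub_sub_sub_cancel_right]

theorem lap_sub_const {α : Type} [Fintype α] [DecidableEq α] (f : Perm α → ℝ) (c : ℝ)
    (p : Perm α) : lap (fun p => f p - c) p = lap f p := by
  simp only [lap, sub_sub_sub_cancel_right]

/-- Functions of one coordinate attain equality in the Poincaré inequality. -/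
theorem rtDirichlet_coord (n : ℕ) (hn : 2 ≤ n) (g : Fin n → ℝ) (k : Fin n) :
    rtDirichlet n (fun p => g (p k)) = 2 / n * unifVar n (fun p => g (p k)) := by
  set f : Perm (Fin n) → ℝ := fun p => g (p k)
  have hlap : ∀ p, lap (fun p => f p - unifMean n f) p =
      2 * n * (f p - unifMean n f) - (2 * ∑ m, g m - 2 * n * unifMean n f) := fun p => by
    rw [lap_sub_const, lap_apply_coord, Fintype.card_fin]
    ring
  rw [rtDirichlet_eq, two_div_mul_unifVar_eq n hn, ← energy_sub_const f (unifMean n f),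
    energy_eq_of_lap_eq (lap_eq_of_sum_eq_zero hlap (sum_sub_unifMean n f))]
  ring

end RandomTranspositions

open RandomTranspositions in
/-- The spectral gap of the random transpositions walk on `S_n` is exactly `2/n`:
the Poincaré inequality holds with constant `2/n`, and `2/n` is the largest such constant. -/
theorem rtKernel_spectral_gap (n : ℕ) (hn : 2 ≤ n) :
    (∀ f : Equiv.Perm (Fin n) → ℝ, (2 / n) * unifVar n f ≤ rtDirichlet n f) ∧
      ∀ lam : ℝ, (∀ f : Equiv.Perm (Fin n) → ℝ, lam * unifVar n f ≤ rtDirichlet n f) →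
        lam ≤ 2 / n := by
  refine ⟨fun f => ?_, fun lam h => ?_⟩
  · rw [rtDirichlet_eq, two_div_mul_unifVar_eq n hn, ← energy_sub_const f (unifMean n f)]
    gcongr
    exact poincare n (Fin n) (Fintype.card_fin n) _ (sum_sub_unifMean n f)
  · let a : Fin n := ⟨0, by omega⟩
    let b : Fin n := ⟨1, by omega⟩
    let f : Equiv.Perm (Fin n) → ℝ := fun p => if p a = a then 1 else 0
    have hab : b ≠ a := by simp [a, b]
    have hf := h f
    rw [rtDirichlet_coord n hn (fun x => if x = a then 1 else 0) a] at hf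
    refine le_of_mul_le_mul_right hf ?_
    have hnn : ∀ p ∈ Finset.univ, 0 ≤ (f p - unifMean n f) ^ 2 := fun p _ => sq_nonneg _
    refine div_pos ((Finset.sum_nonneg hnn).lt_of_ne' fun h0 => ?_)
      (Nat.cast_pos.2 Fintype.card_pos)
    rw [Finset.sum_eq_zero_iff_of_nonneg hnn] at h0
    have h1 := h0 1 (Finset.mem_univ _)
    have h2 := h0 (Equiv.swap a b) (Finset.mem_univ _)
    have e1 : f 1 = 1 := by simp [f]
    have e2 : f (Equiv.swap a b) = 0 := by simp [f, hab]
    rw [e1, sq_eq_zero_iff] at h1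
    rw [e2, sq_eq_zero_iff] at h2
    linarith
end

section
/- Let M be an n×n Hermitian matrix, 1 ≤ k ≤ n, A a uniformly random k×k principal submatrix of M, and F(x) = E[F_A(x)]. Then for every r ≥ 0, P(||F_A − F||_∞ ≥ k^{−1/2} + r) ≤ 12·√k·exp(−r·√(k/8)). -/
open scoped Classical
open Matrix Finset

/-- Empirical spectral distribution function of a Hermitian matrix. -/
noncomputable def esd {m : Type*} [Fintype m] [DecidableEq m] {A : Matrix m m ℂ}
    (hA : A.IsHermitian) (x : ℝ) : ℝ :=
  ((Finset.univ.filter fun i => hA.eigenvalues i ≤ x).card : ℝ) / Fintype.card m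

/-- ESD at `x` of the principal submatrix of `M` indexed by `p 1, …, p k`. -/
noncomputable def fESD {n k : ℕ} (hk : k ≤ n) (M : Matrix (Fin n) (Fin n) ℂ)
    (hM : M.IsHermitian) (p : Equiv.Perm (Fin n)) (x : ℝ) : ℝ :=
  esd (hM.submatrix (fun a : Fin k => p (Fin.castLE hk a))) x

/-- `F(x) = E[F_A(x)]` for a uniformly random `k × k` principal submatrix. -/
noncomputable def meanESD {n k : ℕ} (hk : k ≤ n) (M : Matrix (Fin n) (Fin n) ℂ)
    (hM : M.IsHermitian) (x : ℝ) : ℝ :=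
  (∑ p : Equiv.Perm (Fin n), fESD hk M hM p x) / Fintype.card (Equiv.Perm (Fin n))

/-- Quadratic form of a Hermitian matrix in an eigenbasis. -/
lemma inner_toEuclideanLin_eq_sum {m : Type*} [Fintype m] [DecidableEq m] {A : Matrix m m ℂ}
    (hA : A.IsHermitian) (v : EuclideanSpace ℂ m) :
    inner ℂ v (toEuclideanLin A v) =
      ((∑ i, hA.eigenvalues i * ‖inner ℂ (hA.eigenvectorBasis i) v‖ ^ 2 : ℝ) : ℂ) := by
  have hs := isSymmetric_toEuclideanLin_iff.2 hA
  rw [← hA.eigenvectorBasis.sum_inner_mul_inner]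
  push_cast
  refine Finset.sum_congr rfl fun i _ => ?_
  have h1 : toEuclideanLin A (hA.eigenvectorBasis i) =
      (hA.eigenvalues i : ℂ) • hA.eigenvectorBasis i := by
    ext j
    have := congrFun (hA.mulVec_eigenvectorBasis i) j
    simpa [toLpLin_apply] using this
  have h2 : inner ℂ (hA.eigenvectorBasis i) (toEuclideanLin A v) =
      (hA.eigenvalues i : ℂ) * inner ℂ (hA.eigenvectorBasis i) v := by
    rw [← hs, h1, inner_smul_left, Complex.conj_ofReal]
  rw [h2, ← inner_conj_symm v, mul_left_comm, RCLike.conj_mul]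
  simp

/-- The quadratic forms of two matrices agreeing off `T` coincide on vectors vanishing on `T`. -/
lemma inner_toEuclideanLin_congr {m : Type*} [Fintype m] [DecidableEq m] {A B : Matrix m m ℂ}
    {T : Finset m} (h : ∀ i ∉ T, ∀ j ∉ T, A i j = B i j) {v : EuclideanSpace ℂ m}
    (hv : ∀ i ∈ T, v i = 0) :
    inner ℂ v (toEuclideanLin A v) = inner ℂ v (toEuclideanLin B v) := by
  simp only [PiLp.inner_apply, toLpLin_apply, RCLike.inner_apply, mulVec, dotProduct]
  refine Finset.sum_congr rfl fun i _ => ?_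
  by_cases hi : i ∈ T
  · simp [hv i hi]
  congr 1
  refine Finset.sum_congr rfl fun j _ => ?_
  by_cases hj : j ∈ T
  · simp [hv j hj]
  rw [h i hi j hj]

/-- Hermitian matrices agreeing off `T` have eigenvalue counting functions within `#T`. -/
lemma card_eigenvalues_le_add_card {m : Type*} [Fintype m] [DecidableEq m] {A B : Matrix m m ℂ}
    (hA : A.IsHermitian) (hB : B.IsHermitian) {T : Finset m}
    (h : ∀ i ∉ T, ∀ j ∉ T, A i j = B i j) (x : ℝ) :
    (Finset.univ.filter fun i => hA.eigenvalues i ≤ x).card ≤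
      (Finset.univ.filter fun i => hB.eigenvalues i ≤ x).card + T.card := by
  let LA : EuclideanSpace ℂ m →ₗ[ℂ] ({i // ¬ hA.eigenvalues i ≤ x} → ℂ) :=
    LinearMap.pi fun i => (innerSL ℂ (hA.eigenvectorBasis i)).toLinearMap
  let LB : EuclideanSpace ℂ m →ₗ[ℂ] ({i // hB.eigenvalues i ≤ x} → ℂ) :=
    LinearMap.pi fun i => (innerSL ℂ (hB.eigenvectorBasis i)).toLinearMap
  let LT : EuclideanSpace ℂ m →ₗ[ℂ] (T → ℂ) :=
    LinearMap.pi fun i => (EuclideanSpace.proj (𝕜 := ℂ) (i.1 : m) : EuclideanSpace ℂ m →L[ℂ] ℂ).toLinearMap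
  have hinj : Function.Injective (LA.prod (LB.prod LT)) := by
    rw [← LinearMap.ker_eq_bot, LinearMap.ker_eq_bot']
    intro v hv
    simp only [LinearMap.prod_apply, Function.prod_apply, Prod.mk_eq_zero] at hv
    obtain ⟨h1, h2, h3⟩ := hv
    have hA0 : ∀ i, ¬ hA.eigenvalues i ≤ x → inner ℂ (hA.eigenvectorBasis i) v = 0 :=
      fun i hi => congrFun h1 ⟨i, hi⟩
    have hB0 : ∀ i, hB.eigenvalues i ≤ x → inner ℂ (hB.eigenvectorBasis i) v = 0 :=
      fun i hi => congrFun h2 ⟨i, hi⟩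
    have hT0 : ∀ i ∈ T, v i = 0 := fun i hi => congrFun h3 ⟨i, hi⟩
    have key := inner_toEuclideanLin_congr h hT0
    rw [inner_toEuclideanLin_eq_sum hA, inner_toEuclideanLin_eq_sum hB, Complex.ofReal_inj] at key
    have nA := hA.eigenvectorBasis.sum_sq_norm_inner_right v
    have nB := hB.eigenvectorBasis.sum_sq_norm_inner_right v
    have leA : ∑ i, hA.eigenvalues i * ‖inner ℂ (hA.eigenvectorBasis i) v‖ ^ 2 ≤
        x * ‖v‖ ^ 2 := by
      rw [← nA, Finset.mul_sum]
      refine Finset.sum_le_sum fun i _ => ?_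
      by_cases hi : hA.eigenvalues i ≤ x
      · gcongr
      · simp [hA0 i hi]
    have hterm : ∀ i ∈ Finset.univ,
        0 ≤ (hB.eigenvalues i - x) * ‖inner ℂ (hB.eigenvectorBasis i) v‖ ^ 2 := by
      intro i _
      by_cases hi : hB.eigenvalues i ≤ x
      · simp [hB0 i hi]
      · exact mul_nonneg (by linarith) (by positivity)
    have hsum : ∑ i, (hB.eigenvalues i - x) * ‖inner ℂ (hB.eigenvectorBasis i) v‖ ^ 2 = 0 := by
      refine le_antisymm ?_ (Finset.sum_nonneg hterm)
      simp only [sub_mul, Finset.sum_sub_distrib, ← Finset.mul_sum, nB]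
      linarith
    have hz : ∀ i, inner ℂ (hB.eigenvectorBasis i) v = 0 := by
      intro i
      by_cases hi : hB.eigenvalues i ≤ x
      · exact hB0 i hi
      have := (Finset.sum_eq_zero_iff_of_nonneg hterm).1 hsum i (Finset.mem_univ i)
      rcases mul_eq_zero.1 this with h' | h'
      · exact absurd (by linarith) hi
      · simpa using h'
    have : ‖v‖ ^ 2 = 0 := by rw [← nB]; simp [hz]
    simpa using this
  have hfin := LinearMap.finrank_le_finrank_of_injective hinj
  simp only [finrank_euclideanSpace, Module.finrank_prod, Module.finrank_fintype_fun_eq_card,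
    Fintype.card_subtype, Finset.filter_univ_mem] at hfin
  have hc := Finset.card_filter_add_card_filter_not (s := (Finset.univ : Finset m))
    (fun i => hA.eigenvalues i ≤ x)
  rw [Finset.card_univ] at hc
  omega

lemma abs_esd_sub_le {m : Type*} [Fintype m] [DecidableEq m] {A B : Matrix m m ℂ}
    (hA : A.IsHermitian) (hB : B.IsHermitian) {T : Finset m}
    (h : ∀ i ∉ T, ∀ j ∉ T, A i j = B i j) (x : ℝ) :
    |esd hA x - esd hB x| ≤ T.card / Fintype.card m := by
  have h1 : (_ : ℝ) ≤ _ := Nat.cast_le.2 (card_eigenvalues_le_add_card hA hB h x)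
  have h2 : (_ : ℝ) ≤ _ := Nat.cast_le.2 (card_eigenvalues_le_add_card hB hA
    (fun i hi j hj => (h i hi j hj).symm) x)
  push_cast at h1 h2
  simp only [esd]
  rw [← sub_div, abs_div, abs_of_nonneg (Nat.cast_nonneg (α := ℝ) (Fintype.card m))]
  gcongr
  exact abs_le.2 ⟨by linarith, by linarith⟩

/-- Hoeffding's lemma for a uniform average over a finite set. -/
lemma sum_exp_le_of_sum_eq_zero {ι : Type*} (s : Finset ι) (y : ι → ℝ) {D : ℝ} (hD : 0 < D)
    (hy : ∀ i ∈ s, |y i| ≤ D) (h0 : ∑ i ∈ s, y i = 0) (t : ℝ) :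
    ∑ i ∈ s, Real.exp (t * y i) ≤ s.card * Real.exp (t ^ 2 * D ^ 2 / 2) := by
  have hpt : ∀ i ∈ s, Real.exp (t * y i) ≤
      Real.cosh (t * D) + y i * (Real.sinh (t * D) / D) := by
    intro i hi
    obtain ⟨h1, h2⟩ := abs_le.1 (hy i hi)
    have hc := convexOn_exp.2 (Set.mem_univ (t * D)) (Set.mem_univ (-(t * D)))
      (show 0 ≤ (D + y i) / (2 * D) from div_nonneg (by linarith) (by linarith))
      (show 0 ≤ (D - y i) / (2 * D) from div_nonneg (by linarith) (by linarith))
      (by field_simp; ring)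
    simp only [smul_eq_mul] at hc
    have harg : (D + y i) / (2 * D) * (t * D) + (D - y i) / (2 * D) * -(t * D) = t * y i := by
      field_simp
      ring
    rw [harg] at hc
    refine hc.trans (le_of_eq ?_)
    rw [Real.cosh_eq, Real.sinh_eq]
    generalize Real.exp (t * D) = u
    generalize Real.exp (-(t * D)) = v
    field_simp
    ring
  calc ∑ i ∈ s, Real.exp (t * y i)
      ≤ ∑ i ∈ s, (Real.cosh (t * D) + y i * (Real.sinh (t * D) / D)) := Finset.sum_le_sum hpt
    _ = s.card * Real.cosh (t * D) := by
      rw [Finset.sum_add_distrib, ← Finset.sum_mul, h0]; simp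
    _ ≤ s.card * Real.exp (t ^ 2 * D ^ 2 / 2) := by
      rw [← mul_pow]; gcongr; exact Real.cosh_le_exp_half_sq _

/-- A function on permutations depending only on the first `j` values and moving by at most `c`
under each transposition is sub-Gaussian. -/
lemma sum_perm_exp_le {n : ℕ} {c : ℝ} (hc : 0 < c) (t : ℝ) (j : ℕ) (hj : j ≤ n)
    (g : Equiv.Perm (Fin n) → ℝ)
    (hinv : ∀ p s : Equiv.Perm (Fin n), (∀ i : Fin n, (i : ℕ) < j → s i = i) → g (p * s) = g p)
    (hlip : ∀ (p : Equiv.Perm (Fin n)) (a b : Fin n), |g (p * Equiv.swap a b) - g p| ≤ c) :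
    ∑ p, Real.exp (t * g p) ≤ Fintype.card (Equiv.Perm (Fin n)) *
      Real.exp (t * ((∑ p, g p) / Fintype.card (Equiv.Perm (Fin n))) +
        j * (t ^ 2 * (2 * c) ^ 2 / 2)) := by
  induction j generalizing g with
  | zero =>
    have hconst : ∀ p, g p = g 1 := fun p => by simpa using hinv 1 p (by simp)
    have hN : (Fintype.card (Equiv.Perm (Fin n)) : ℝ) ≠ 0 := by
      exact_mod_cast Fintype.card_ne_zero
    simp only [hconst, Finset.sum_const, Finset.card_univ, nsmul_eq_mul]
    rw [mul_div_cancel_left₀ _ hN]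
    simp
  | succ j ih =>
    let o : Fin n := ⟨j, hj⟩
    let S : Finset (Fin n) := Finset.Ici o
    have hS : (0 : ℝ) < S.card := by
      exact_mod_cast Finset.card_pos.2 ⟨o, Finset.mem_Ici.2 le_rfl⟩
    let g' : Equiv.Perm (Fin n) → ℝ := fun p => (∑ b ∈ S, g (p * Equiv.swap o b)) / S.card
    have hdev : ∀ p, |g' p - g p| ≤ c := by
      intro p
      have : g' p - g p = (∑ b ∈ S, (g (p * Equiv.swap o b) - g p)) / S.card := by
        simp only [g', Finset.sum_sub_distrib, Finset.sum_const, nsmul_eq_mul]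
        field_simp
      rw [this, abs_div, abs_of_pos hS, div_le_iff₀ hS]
      refine (Finset.abs_sum_le_sum_abs _ _).trans ?_
      refine (Finset.sum_le_card_nsmul _ _ c fun b _ => hlip p o b).trans ?_
      rw [nsmul_eq_mul, mul_comm]
    have hsum : ∑ p, g' p = ∑ p, g p := by
      simp only [g']
      rw [← Finset.sum_div, Finset.sum_comm]
      have : ∀ b ∈ S, ∑ p, g (p * Equiv.swap o b) = ∑ p, g p := fun b _ =>
        Equiv.sum_comp (Equiv.mulRight (Equiv.swap o b)) g
      rw [Finset.sum_congr rfl this, Finset.sum_const, nsmul_eq_mul]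
      field_simp
    have hlip' : ∀ (p : Equiv.Perm (Fin n)) (a b : Fin n),
        |g' (p * Equiv.swap a b) - g' p| ≤ c := by
      intro p a b
      simp only [g']
      rw [← sub_div, ← Finset.sum_sub_distrib, abs_div, abs_of_pos hS, div_le_iff₀ hS]
      refine (Finset.abs_sum_le_sum_abs _ _).trans ?_
      refine (Finset.sum_le_card_nsmul _ _ c fun d _ => ?_).trans (by rw [nsmul_eq_mul, mul_comm])
      have : p * Equiv.swap a b * Equiv.swap o d = p * Equiv.swap o d *
          Equiv.swap (Equiv.swap o d a) (Equiv.swap o d b) := by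
        rw [mul_assoc, mul_assoc, Equiv.mul_swap_eq_swap_mul (Equiv.swap o d)]
        simp
      rw [this]
      exact hlip _ _ _
    have hinv' : ∀ p s : Equiv.Perm (Fin n), (∀ i : Fin n, (i : ℕ) < j → s i = i) →
        g' (p * s) = g' p := by
      intro p s hs
      simp only [g']
      congr 1
      have hmem : ∀ b, b ∈ S → s b ∈ S := by
        intro b hb
        simp only [S, Finset.mem_Ici, o, Fin.le_def] at hb ⊢
        by_contra hlt
        have h1 := s.injective (hs (s b) (by omega))
        rw [h1] at hlt
        omega
      have himg : S.map s.toEmbedding = S := by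
        refine Finset.eq_of_subset_of_card_le (fun x hx => ?_) (by simp)
        obtain ⟨b, hb, rfl⟩ := Finset.mem_map.1 hx
        exact hmem b hb
      conv_rhs => rw [← himg, Finset.sum_map]
      refine Finset.sum_congr rfl fun b hb => ?_
      have : p * s * Equiv.swap o b = p * Equiv.swap o (s b) *
          (Equiv.swap o (s b) * s * Equiv.swap o b) := by
        simp only [mul_assoc, Equiv.swap_mul_self_mul]
      rw [this]
      refine hinv _ _ fun i hi => ?_
      have hb' := hmem b hb
      simp only [S, Finset.mem_Ici, o, Fin.le_def] at hb hb'
      rcases Nat.lt_succ_iff_lt_or_eq.1 hi with hlt | heq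
      · have e1 : i ≠ o := fun h => by simp [h, o] at hlt
        have e2 : i ≠ b := fun h => by rw [h] at hlt; omega
        have e3 : i ≠ s b := fun h => by rw [h] at hlt; omega
        simp [Equiv.swap_apply_of_ne_of_ne e1 e2, hs i hlt, Equiv.swap_apply_of_ne_of_ne e1 e3]
      · have : i = o := Fin.ext heq
        simp [this]
    have hstep : ∑ p, Real.exp (t * g p) ≤
        Real.exp (t ^ 2 * (2 * c) ^ 2 / 2) * ∑ p, Real.exp (t * g' p) := by
      have havg : S.card * ∑ p, Real.exp (t * g p) =
          ∑ p, ∑ b ∈ S, Real.exp (t * g (p * Equiv.swap o b)) := by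
        rw [Finset.sum_comm]
        have : ∀ b ∈ S, ∑ p, Real.exp (t * g (p * Equiv.swap o b)) = ∑ p, Real.exp (t * g p) :=
          fun b _ => Equiv.sum_comp (Equiv.mulRight (Equiv.swap o b)) fun p => Real.exp (t * g p)
        rw [Finset.sum_congr rfl this, Finset.sum_const, nsmul_eq_mul]
      have hle : ∀ p, ∑ b ∈ S, Real.exp (t * g (p * Equiv.swap o b)) ≤
          S.card * (Real.exp (t ^ 2 * (2 * c) ^ 2 / 2) * Real.exp (t * g' p)) := by
        intro p
        have hoeff := sum_exp_le_of_sum_eq_zero S (fun b => g (p * Equiv.swap o b) - g' p)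
          (D := 2 * c) (by linarith)
          (fun b _ => by
            have h1 := abs_le.1 (hlip p o b)
            have h2 := abs_le.1 (hdev p)
            exact abs_le.2 ⟨by linarith, by linarith⟩)
          (by
            simp only [Finset.sum_sub_distrib, Finset.sum_const, nsmul_eq_mul, g']
            field_simp
            ring) t
        calc ∑ b ∈ S, Real.exp (t * g (p * Equiv.swap o b))
            = (∑ b ∈ S, Real.exp (t * (g (p * Equiv.swap o b) - g' p))) *
                Real.exp (t * g' p) := by
              rw [Finset.sum_mul]
              refine Finset.sum_congr rfl fun b _ => ?_
              rw [← Real.exp_add]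
              congr 1
              ring
          _ ≤ _ := by
              rw [← mul_assoc]
              gcongr
      refine le_of_mul_le_mul_left ?_ hS
      rw [havg, Finset.mul_sum, Finset.mul_sum]
      exact Finset.sum_le_sum fun p _ => hle p
    refine hstep.trans ?_
    have := ih (by omega) g' hinv' hlip'
    rw [hsum] at this
    refine (mul_le_mul_of_nonneg_left this (Real.exp_pos _).le).trans (le_of_eq ?_)
    rw [mul_left_comm, ← Real.exp_add]
    congr 2
    push_cast
    ring

lemma fESD_mul_of_fix {n k : ℕ} (hk : k ≤ n) (M : Matrix (Fin n) (Fin n) ℂ) (hM : M.IsHermitian)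
    (x : ℝ) (p s : Equiv.Perm (Fin n)) (hs : ∀ i : Fin n, (i : ℕ) < k → s i = i) :
    fESD hk M hM (p * s) x = fESD hk M hM p x := by
  have : (fun a : Fin k => (p * s) (Fin.castLE hk a)) = fun a => p (Fin.castLE hk a) := by
    funext a
    simp [hs (Fin.castLE hk a) a.2]
  simp only [fESD, this]

lemma abs_fESD_mul_swap_sub_le {n k : ℕ} (hk0 : 0 < k) (hk : k ≤ n)
    (M : Matrix (Fin n) (Fin n) ℂ) (hM : M.IsHermitian) (x : ℝ) (p : Equiv.Perm (Fin n))
    (a b : Fin n) :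
    |fESD hk M hM (p * Equiv.swap a b) x - fESD hk M hM p x| ≤ 2 / k := by
  let T : Finset (Fin k) := Finset.univ.filter fun i => Fin.castLE hk i ∈ ({a, b} : Finset (Fin n))
  have hT : T.card ≤ 2 := by
    refine le_trans ?_ (Finset.card_le_two (a := a) (b := b))
    exact Finset.card_le_card_of_injOn (Fin.castLE hk) (fun i hi => (Finset.mem_filter.1 hi).2)
      (Fin.castLE_injective hk).injOn
  have hfix : ∀ i ∉ T, (p * Equiv.swap a b) (Fin.castLE hk i) = p (Fin.castLE hk i) := by
    intro i hi
    simp only [T, Finset.mem_filter, Finset.mem_univ, true_and, Finset.mem_insert,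
      Finset.mem_singleton, not_or] at hi
    simp [Equiv.swap_apply_of_ne_of_ne hi.1 hi.2]
  have hk' : (0 : ℝ) < k := by exact_mod_cast hk0
  refine (abs_esd_sub_le _ _ (T := T) (fun i hi j hj => ?_) x).trans ?_
  · simp only [submatrix_apply, hfix i hi, hfix j hj]
  · rw [Fintype.card_fin]
    gcongr
    exact_mod_cast hT

lemma fESD_mono {n k : ℕ} (hk : k ≤ n) (M : Matrix (Fin n) (Fin n) ℂ) (hM : M.IsHermitian)
    (p : Equiv.Perm (Fin n)) : Monotone (fESD hk M hM p) := by
  intro x y hxy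
  simp only [fESD, esd]
  gcongr with i hi

lemma fESD_nonneg {n k : ℕ} (hk : k ≤ n) (M : Matrix (Fin n) (Fin n) ℂ) (hM : M.IsHermitian)
    (p : Equiv.Perm (Fin n)) (x : ℝ) : 0 ≤ fESD hk M hM p x := by
  simp only [fESD, esd]
  positivity

lemma fESD_le_one {n k : ℕ} (hk : k ≤ n) (M : Matrix (Fin n) (Fin n) ℂ) (hM : M.IsHermitian)
    (p : Equiv.Perm (Fin n)) (x : ℝ) : fESD hk M hM p x ≤ 1 := by
  simp only [fESD, esd]
  refine div_le_one_of_le₀ ?_ (by positivity)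
  exact_mod_cast Finset.card_le_univ _

lemma meanESD_nonneg {n k : ℕ} (hk : k ≤ n) (M : Matrix (Fin n) (Fin n) ℂ) (hM : M.IsHermitian)
    (x : ℝ) : 0 ≤ meanESD hk M hM x :=
  div_nonneg (Finset.sum_nonneg fun p _ => fESD_nonneg hk M hM p x) (by positivity)

lemma meanESD_le_one {n k : ℕ} (hk : k ≤ n) (M : Matrix (Fin n) (Fin n) ℂ) (hM : M.IsHermitian)
    (x : ℝ) : meanESD hk M hM x ≤ 1 := by
  refine div_le_one_of_le₀ ?_ (by positivity)
  refine (Finset.sum_le_card_nsmul _ _ 1 fun p _ => fESD_le_one hk M hM p x).trans ?_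
  simp [Finset.card_univ]

lemma meanESD_mono {n k : ℕ} (hk : k ≤ n) (M : Matrix (Fin n) (Fin n) ℂ) (hM : M.IsHermitian) :
    Monotone (meanESD hk M hM) := by
  intro x y hxy
  simp only [meanESD]
  gcongr with p
  exact fESD_mono hk M hM p hxy

/-- Where `F` does not vary, no `F_A` does. -/
lemma fESD_eq_of_meanESD_eq {n k : ℕ} (hk : k ≤ n) (M : Matrix (Fin n) (Fin n) ℂ)
    (hM : M.IsHermitian) {x y : ℝ} (hxy : x ≤ y) (h : meanESD hk M hM x = meanESD hk M hM y)
    (p : Equiv.Perm (Fin n)) : fESD hk M hM p x = fESD hk M hM p y := by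
  have hN : (Fintype.card (Equiv.Perm (Fin n)) : ℝ) ≠ 0 := by
    exact_mod_cast Fintype.card_ne_zero
  simp only [meanESD] at h
  rw [div_left_inj' hN] at h
  exact (Finset.sum_eq_sum_iff_of_le fun q _ => fESD_mono hk M hM q hxy).1 h p (Finset.mem_univ p)

lemma finite_range_fESD {n k : ℕ} (hk : k ≤ n) (M : Matrix (Fin n) (Fin n) ℂ)
    (hM : M.IsHermitian) (p : Equiv.Perm (Fin n)) : (Set.range (fESD hk M hM p)).Finite := by
  refine ((Set.finite_Iic k).image fun m : ℕ => (m : ℝ) / k).subset ?_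
  rintro _ ⟨x, rfl⟩
  refine ⟨_, ?_, by simp only [fESD, esd, Fintype.card_fin]; rfl⟩
  exact (Finset.card_le_univ _).trans (by simp)

lemma finite_range_meanESD {n k : ℕ} (hk : k ≤ n) (M : Matrix (Fin n) (Fin n) ℂ)
    (hM : M.IsHermitian) : (Set.range (meanESD hk M hM)).Finite := by
  refine ((Set.Finite.pi' (finite_range_fESD hk M hM)).image fun v : Equiv.Perm (Fin n) → ℝ =>
    (∑ p, v p) / Fintype.card (Equiv.Perm (Fin n))).subset ?_
  rintro _ ⟨x, rfl⟩
  exact ⟨fun p => fESD hk M hM p x, fun p => ⟨x, rfl⟩, rfl⟩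

/-- A nonempty set of reals contains a point where all `F_A` are simultaneously minimal on it. -/
lemma exists_min_fESD {n k : ℕ} (hk : k ≤ n) (M : Matrix (Fin n) (Fin n) ℂ)
    (hM : M.IsHermitian) (S : Set ℝ) (hS : S.Nonempty) :
    ∃ a ∈ S, ∀ x ∈ S, ∀ p, fESD hk M hM p a ≤ fESD hk M hM p x := by
  have hfin : (meanESD hk M hM '' S).Finite :=
    (finite_range_meanESD hk M hM).subset (Set.image_subset_range _ _)
  obtain ⟨_, ⟨a, ha, rfl⟩, hmin⟩ := Set.exists_min_image _ id hfin (hS.image _)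
  refine ⟨a, ha, fun x hx p => ?_⟩
  rcases le_total a x with h | h
  · exact fESD_mono hk M hM p h
  · exact (fESD_eq_of_meanESD_eq hk M hM h
      (le_antisymm (meanESD_mono hk M hM h) (hmin _ ⟨x, hx, rfl⟩)) p).ge

/-- A nonempty set of reals contains a point where all `F_A` are simultaneously maximal on it. -/
lemma exists_max_fESD {n k : ℕ} (hk : k ≤ n) (M : Matrix (Fin n) (Fin n) ℂ)
    (hM : M.IsHermitian) (S : Set ℝ) (hS : S.Nonempty) :
    ∃ b ∈ S, ∀ x ∈ S, ∀ p, fESD hk M hM p x ≤ fESD hk M hM p b := by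
  have hfin : (meanESD hk M hM '' S).Finite :=
    (finite_range_meanESD hk M hM).subset (Set.image_subset_range _ _)
  obtain ⟨_, ⟨b, hb, rfl⟩, hmax⟩ := Set.exists_max_image _ id hfin (hS.image _)
  refine ⟨b, hb, fun x hx p => ?_⟩
  rcases le_total x b with h | h
  · exact fESD_mono hk M hM p h
  · exact (fESD_eq_of_meanESD_eq hk M hM h
      (le_antisymm (meanESD_mono hk M hM h) (hmax _ ⟨x, hx, rfl⟩)) p).ge

/-- One-sided tail bounds for `F_A x - F x`; the sign `e` selects the side. -/
lemma card_fESD_tail_le {n k : ℕ} (hk0 : 0 < k) (hk : k ≤ n) (M : Matrix (Fin n) (Fin n) ℂ)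
    (hM : M.IsHermitian) (x : ℝ) {r : ℝ} (hr : 0 ≤ r) {e : ℝ} (he : e ^ 2 = 1) :
    ((Finset.univ.filter fun p : Equiv.Perm (Fin n) =>
        r ≤ e * (fESD hk M hM p x - meanESD hk M hM x)).card : ℝ) ≤
      Fintype.card (Equiv.Perm (Fin n)) * Real.exp (-(r ^ 2 * k / 32)) := by
  have hk' : (0 : ℝ) < k := by exact_mod_cast hk0
  have hmgf := sum_perm_exp_le (c := 2 / k) (by positivity) (e * (r * k / 16)) k hk
    (fun p => fESD hk M hM p x) (fun p s hs => fESD_mul_of_fix hk M hM x p s hs)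
    (fun p a b => abs_fESD_mul_swap_sub_le hk0 hk M hM x p a b)
  have hmarkov : ((Finset.univ.filter fun p : Equiv.Perm (Fin n) =>
        r ≤ e * (fESD hk M hM p x - meanESD hk M hM x)).card : ℝ) *
      Real.exp (r * k / 16 * r + e * (r * k / 16) * meanESD hk M hM x) ≤
      ∑ p, Real.exp (e * (r * k / 16) * fESD hk M hM p x) := by
    rw [← nsmul_eq_mul]
    refine (Finset.card_nsmul_le_sum _ _ _ fun p hp => ?_).trans
      (Finset.sum_le_sum_of_subset_of_nonneg (Finset.filter_subset _ _)
        fun p _ _ => (Real.exp_pos _).le)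
    have h := mul_le_mul_of_nonneg_left (Finset.mem_filter.1 hp).2
      (show 0 ≤ r * k / 16 by positivity)
    gcongr
    linarith
  refine le_of_mul_le_mul_right ((hmarkov.trans hmgf).trans (le_of_eq ?_)) (Real.exp_pos _)
  rw [mul_assoc (Fintype.card (Equiv.Perm (Fin n)) : ℝ), ← Real.exp_add]
  congr 2
  have : (∑ p, fESD hk M hM p x) / (Fintype.card (Equiv.Perm (Fin n)) : ℝ) =
    meanESD hk M hM x := rfl
  rw [this, mul_pow, he]
  field_simp
  ring

/-- Concentration of the ESD of a random principal submatrix in sup norm: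
`P(‖F_A - F‖_∞ ≥ k^{-1/2} + r) ≤ 12 √k exp(-r √(k/8))`. -/
theorem esd_sup_concentration {n k : ℕ} (hk0 : 0 < k) (hk : k ≤ n)
    (M : Matrix (Fin n) (Fin n) ℂ) (hM : M.IsHermitian) (r : ℝ) (hr : 0 ≤ r) :
    ((Finset.univ.filter fun p : Equiv.Perm (Fin n) =>
        1 / Real.sqrt k + r ≤ ⨆ x : ℝ, |fESD hk M hM p x - meanESD hk M hM x|).card : ℝ) /
        Fintype.card (Equiv.Perm (Fin n)) ≤
      12 * Real.sqrt k * Real.exp (-(r * Real.sqrt (k / 8))) := by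
  have hk' : (0 : ℝ) < k := by exact_mod_cast hk0
  have hN : (0 : ℝ) < Fintype.card (Equiv.Perm (Fin n)) := by exact_mod_cast Fintype.card_pos
  have hq : 0 < Real.sqrt k := Real.sqrt_pos.2 hk'
  have hq1 : 1 ≤ Real.sqrt k := Real.one_le_sqrt.2 (by exact_mod_cast hk0)
  let cell : ℕ → Set ℝ := fun j => {x | ⌊Real.sqrt k * meanESD hk M hM x⌋₊ = j}
  have hclose : ∀ j, ∀ x ∈ cell j, ∀ y ∈ cell j,
      meanESD hk M hM y < meanESD hk M hM x + 1 / Real.sqrt k := by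
    intro j x hx y hy
    have h1 := Nat.floor_le (mul_nonneg hq.le (meanESD_nonneg hk M hM x))
    have h2 := Nat.lt_floor_add_one (Real.sqrt k * meanESD hk M hM y)
    rw [show ⌊Real.sqrt k * meanESD hk M hM x⌋₊ = j from hx] at h1
    rw [show ⌊Real.sqrt k * meanESD hk M hM y⌋₊ = j from hy] at h2
    rw [← mul_lt_mul_iff_right₀ hq, mul_add, mul_one_div_cancel hq.ne']
    linarith
  have hlo : ∀ j, ∃ a, (cell j).Nonempty →
      a ∈ cell j ∧ ∀ x ∈ cell j, ∀ p, fESD hk M hM p a ≤ fESD hk M hM p x := by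
    intro j
    by_cases h : (cell j).Nonempty
    · obtain ⟨a, ha⟩ := exists_min_fESD hk M hM _ h
      exact ⟨a, fun _ => ha⟩
    · exact ⟨0, fun h' => absurd h' h⟩
  have hhi : ∀ j, ∃ b, (cell j).Nonempty →
      b ∈ cell j ∧ ∀ x ∈ cell j, ∀ p, fESD hk M hM p x ≤ fESD hk M hM p b := by
    intro j
    by_cases h : (cell j).Nonempty
    · obtain ⟨b, hb⟩ := exists_max_fESD hk M hM _ h
      exact ⟨b, fun _ => hb⟩
    · exact ⟨0, fun h' => absurd h' h⟩
  choose a ha using hlo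
  choose b hb using hhi
  let J := Finset.range (⌊Real.sqrt k⌋₊ + 1)
  let E : ℝ → ℝ → Finset (Equiv.Perm (Fin n)) := fun e x =>
    Finset.univ.filter fun p => r ≤ e * (fESD hk M hM p x - meanESD hk M hM x)
  have hsub : (Finset.univ.filter fun p : Equiv.Perm (Fin n) =>
      1 / Real.sqrt k + r ≤ ⨆ x : ℝ, |fESD hk M hM p x - meanESD hk M hM x|) ⊆
      J.biUnion fun j => E 1 (b j) ∪ E (-1) (a j) := by
    intro p hp
    by_contra hcon
    have hnot : ∀ j ∈ J, fESD hk M hM p (b j) - meanESD hk M hM (b j) < r ∧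
        meanESD hk M hM (a j) - fESD hk M hM p (a j) < r := by
      simpa [E] using hcon
    have hfin : (Set.range fun x => |fESD hk M hM p x - meanESD hk M hM x|).Finite := by
      refine (((finite_range_fESD hk M hM p).prod (finite_range_meanESD hk M hM)).image
        fun u : ℝ × ℝ => |u.1 - u.2|).subset ?_
      rintro _ ⟨x, rfl⟩
      exact ⟨(_, _), ⟨⟨x, rfl⟩, ⟨x, rfl⟩⟩, rfl⟩
    obtain ⟨x, hx⟩ := (Set.range_nonempty _).csSup_mem hfin
    have hle : 1 / Real.sqrt k + r ≤ |fESD hk M hM p x - meanESD hk M hM x| :=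
      (Finset.mem_filter.1 hp).2.trans hx.ge
    let j := ⌊Real.sqrt k * meanESD hk M hM x⌋₊
    have hxj : x ∈ cell j := rfl
    have hj : j ∈ J := Finset.mem_range.2 (Nat.lt_succ_of_le (Nat.floor_le_floor
      (mul_le_of_le_one_right hq.le (meanESD_le_one hk M hM x))))
    obtain ⟨ha1, ha2⟩ := ha j ⟨x, hxj⟩
    obtain ⟨hb1, hb2⟩ := hb j ⟨x, hxj⟩
    obtain ⟨hn1, hn2⟩ := hnot j hj
    have h1 := hclose j x hxj _ hb1
    have h2 := hclose j _ ha1 x hxj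
    have h3 := ha2 x hxj p
    have h4 := hb2 x hxj p
    refine absurd hle (not_le.2 (abs_lt.2 ⟨?_, ?_⟩)) <;> linarith
  have hunion := (Finset.card_le_card hsub).trans (Finset.card_biUnion_le_card_mul J _
    (2 * ⌊Fintype.card (Equiv.Perm (Fin n)) * Real.exp (-(r ^ 2 * k / 32))⌋₊) fun j _ => by
      have h1 := Nat.le_floor (card_fESD_tail_le hk0 hk M hM (b j) hr (e := 1) (by norm_num))
      have h2 := Nat.le_floor (card_fESD_tail_le hk0 hk M hM (a j) hr (e := -1) (by norm_num))
      refine (Finset.card_union_le _ _).trans ?_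
      rw [two_mul]
      exact Nat.add_le_add h1 h2)
  have hcast : (_ : ℝ) ≤ _ := Nat.cast_le.2 hunion
  have hfl := Nat.floor_le (a := Fintype.card (Equiv.Perm (Fin n)) *
    Real.exp (-(r ^ 2 * k / 32))) (by positivity)
  have hJ : (J.card : ℝ) ≤ 2 * Real.sqrt k := by
    have := Nat.floor_le hq.le
    simp only [J, Finset.card_range]
    push_cast
    linarith
  have hexp : Real.exp (-(r ^ 2 * k / 32)) ≤ 3 * Real.exp (-(r * Real.sqrt (k / 8))) := by
    have hs : Real.sqrt (k / 8) ^ 2 = k / 8 := Real.sq_sqrt (by positivity)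
    calc Real.exp (-(r ^ 2 * k / 32))
        ≤ Real.exp (1 + -(r * Real.sqrt (k / 8))) := by
          gcongr
          have : r ^ 2 * k / 32 = (r * Real.sqrt (k / 8)) ^ 2 / 4 := by rw [mul_pow, hs]; ring
          nlinarith [sq_nonneg (r * Real.sqrt (k / 8) - 2)]
      _ ≤ 3 * Real.exp (-(r * Real.sqrt (k / 8))) := by
          rw [Real.exp_add]
          gcongr
          exact Real.exp_one_lt_three.le
  rw [div_le_iff₀ hN]
  push_cast at hcast
  calc _ ≤ _ := hcast
    _ ≤ 2 * Real.sqrt k * (2 * (Fintype.card (Equiv.Perm (Fin n)) *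
          (3 * Real.exp (-(r * Real.sqrt (k / 8)))))) := by
        gcongr
        exact hfl.trans (by gcongr)
    _ = _ := by ring
end

section
/- Let M be an arbitrary n×n complex matrix, 1 ≤ k ≤ n, and let A be a uniformly random k×n submatrix of M (the rows indexed by π(1),...,π(k) for π uniform on S_n). Let F_A be the empirical distribution function of the singular values of A and F(x) = E[F_A(x)]. Then for every r ≥ 0, P(||F_A − F||_∞ ≥ k^{−1/2} + r) ≤ 12·√k·exp(−r·√(k/8)). -/
open scoped Classical
open Matrix Finset

/-- Empirical distribution function of the singular values of a `k × n` matrix `A`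
(the square roots of the eigenvalues of `A Aᴴ`). -/
noncomputable def svESD {k n : ℕ} (A : Matrix (Fin k) (Fin n) ℂ) (x : ℝ) : ℝ :=
  ((Finset.univ.filter fun i =>
      Real.sqrt ((Matrix.isHermitian_mul_conjTranspose_self A).eigenvalues i) ≤ x).card : ℝ) / k

/-- The `k × n` submatrix of `M` with rows `p 1, …, p k`. -/
def rsub {n k : ℕ} (hk : k ≤ n) (M : Matrix (Fin n) (Fin n) ℂ) (p : Equiv.Perm (Fin n)) :
    Matrix (Fin k) (Fin n) ℂ :=
  M.submatrix (fun a => p (Fin.castLE hk a)) id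

/-- `F(x) = E[F_A(x)]` for the singular values of a uniformly random `k × n` submatrix. -/
noncomputable def meanSvESD {n k : ℕ} (hk : k ≤ n) (M : Matrix (Fin n) (Fin n) ℂ) (x : ℝ) : ℝ :=
  (∑ p : Equiv.Perm (Fin n), svESD (rsub hk M p) x) / Fintype.card (Equiv.Perm (Fin n))

/-- Eigenvalue counts of two Gram matrices differ by at most the number of differing rows. -/
theorem card_gram_eigenvalues_le {m : Type*} [Fintype m] [DecidableEq m] {l : Type*} [Fintype l]
    (A B : Matrix m l ℂ) (T : Finset m) (hT : ∀ i ∉ T, A i = B i) (t : ℝ) :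
    (univ.filter fun i => (isHermitian_mul_conjTranspose_self A).eigenvalues i ≤ t).card ≤
      (univ.filter fun i => (isHermitian_mul_conjTranspose_self B).eigenvalues i ≤ t).card
        + T.card := by
  have quad : ∀ (C : Matrix m l ℂ) (v : m → ℂ),
      (∑ i, (isHermitian_mul_conjTranspose_self C).eigenvalues i * Complex.normSq
        ((star ((isHermitian_mul_conjTranspose_self C).eigenvectorUnitary : Matrix m m ℂ) *ᵥ v) i)
        : ℝ) = ∑ j, Complex.normSq ((Cᴴ *ᵥ v) j) := by
    intro C v
    set hC := isHermitian_mul_conjTranspose_self C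
    set U : Matrix m m ℂ := (hC.eigenvectorUnitary : Matrix m m ℂ)
    have h1 : C * Cᴴ = U * diagonal (RCLike.ofReal ∘ hC.eigenvalues) * star U := by
      conv_lhs => rw [hC.spectral_theorem, Unitary.conjStarAlgAut_apply]
    have h2 : star v ⬝ᵥ ((C * Cᴴ) *ᵥ v) = star (Cᴴ *ᵥ v) ⬝ᵥ (Cᴴ *ᵥ v) := by
      rw [star_mulVec, conjTranspose_conjTranspose, ← dotProduct_mulVec, mulVec_mulVec]
    have h3 : star v ⬝ᵥ ((C * Cᴴ) *ᵥ v) = star (star U *ᵥ v) ⬝ᵥ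
        (diagonal (RCLike.ofReal ∘ hC.eigenvalues) *ᵥ (star U *ᵥ v)) := by
      rw [star_mulVec, star_eq_conjTranspose U, conjTranspose_conjTranspose, ← dotProduct_mulVec,
        mulVec_mulVec, mulVec_mulVec, ← star_eq_conjTranspose U, ← h1]
    rw [h2] at h3
    have h4 := congrArg Complex.re h3
    simp only [dotProduct, mulVec_diagonal, Complex.re_sum, Pi.star_apply] at h4
    rw [eq_comm]
    convert h4 using 2 with j _ j _
    · simp [Complex.normSq_apply]
    · simp [Complex.normSq_apply]
      ring
  have unit : ∀ (C : Matrix m l ℂ) (v : m → ℂ),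
      (∑ i, Complex.normSq
        ((star ((isHermitian_mul_conjTranspose_self C).eigenvectorUnitary : Matrix m m ℂ) *ᵥ v) i)
        : ℝ) = ∑ j, Complex.normSq (v j) := by
    intro C v
    set hC := isHermitian_mul_conjTranspose_self C
    set U : Matrix m m ℂ := (hC.eigenvectorUnitary : Matrix m m ℂ)
    have h1 : U * star U = 1 := Unitary.coe_mul_star_self _
    have h3 : star (star U *ᵥ v) ⬝ᵥ (star U *ᵥ v) = star v ⬝ᵥ v := by
      rw [star_mulVec, star_eq_conjTranspose U, conjTranspose_conjTranspose, ← dotProduct_mulVec,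
        mulVec_mulVec, ← star_eq_conjTranspose U, h1, one_mulVec]
    have h4 := congrArg Complex.re h3
    simp only [dotProduct, Complex.re_sum, Pi.star_apply] at h4
    convert h4 using 2 with j _ j _
    · simp [Complex.normSq_apply]
    · simp [Complex.normSq_apply]
  by_contra! hlt
  set hA := isHermitian_mul_conjTranspose_self A
  set hB := isHermitian_mul_conjTranspose_self B
  set UA : Matrix m m ℂ := (hA.eigenvectorUnitary : Matrix m m ℂ)
  set UB : Matrix m m ℂ := (hB.eigenvectorUnitary : Matrix m m ℂ)
  let φ : (m → ℂ) →ₗ[ℂ] ({i // ¬ hA.eigenvalues i ≤ t} → ℂ) × ({i // hB.eigenvalues i ≤ t} → ℂ) ×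
      (T → ℂ) :=
    ((LinearMap.funLeft ℂ ℂ Subtype.val).comp (star UA).mulVecLin).prod
      (((LinearMap.funLeft ℂ ℂ Subtype.val).comp (star UB).mulVecLin).prod
        (LinearMap.funLeft ℂ ℂ Subtype.val))
  have hker : LinearMap.ker φ ≠ ⊥ := by
    apply LinearMap.ker_ne_bot_of_finrank_lt
    rw [Module.finrank_prod, Module.finrank_prod]
    simp only [Module.finrank_fintype_fun_eq_card, Fintype.card_subtype,
      Finset.filter_mem_eq_inter, Finset.univ_inter]
    have := Finset.card_filter_add_card_filter_not (s := (univ : Finset m))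
      (fun i => hA.eigenvalues i ≤ t)
    rw [Finset.card_univ] at this
    omega
  obtain ⟨v, hv, hv0⟩ := Submodule.exists_mem_ne_zero_of_ne_bot hker
  rw [LinearMap.mem_ker] at hv
  have hvA : ∀ i, ¬ hA.eigenvalues i ≤ t → (star UA *ᵥ v) i = 0 := fun i hi =>
    congrFun (congrArg Prod.fst hv) ⟨i, hi⟩
  have hvB : ∀ i, hB.eigenvalues i ≤ t → (star UB *ᵥ v) i = 0 := fun i hi =>
    congrFun (congrArg (fun z => z.2.1) hv) ⟨i, hi⟩
  have hvT : ∀ i ∈ T, v i = 0 := fun i hi =>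
    congrFun (congrArg (fun z => z.2.2) hv) ⟨i, hi⟩
  have hAB : Aᴴ *ᵥ v = Bᴴ *ᵥ v := by
    ext j
    refine Finset.sum_congr rfl fun i _ => ?_
    by_cases hi : i ∈ T
    · simp [hvT i hi]
    · simp [hT i hi]
  have qA := quad A v
  have qB := quad B v
  rw [← hAB, ← qA] at qB
  have hpos : 0 < ∑ j, Complex.normSq (v j) := by
    obtain ⟨j, hj⟩ := Function.ne_iff.1 hv0
    exact Finset.sum_pos' (fun i _ => Complex.normSq_nonneg _)
      ⟨j, mem_univ _, Complex.normSq_pos.2 hj⟩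
  have upper : ∑ i, hA.eigenvalues i * Complex.normSq ((star UA *ᵥ v) i) ≤
      ∑ i, t * Complex.normSq ((star UA *ᵥ v) i) := by
    refine Finset.sum_le_sum fun i _ => ?_
    by_cases hi : hA.eigenvalues i ≤ t
    · exact mul_le_mul_of_nonneg_right hi (Complex.normSq_nonneg _)
    · simp [hvA i hi]
  have lower : ∑ i, t * Complex.normSq ((star UB *ᵥ v) i) <
      ∑ i, hB.eigenvalues i * Complex.normSq ((star UB *ᵥ v) i) := by
    have hpos' : 0 < ∑ i, Complex.normSq ((star UB *ᵥ v) i) := by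
      rw [unit B v]; exact hpos
    obtain ⟨j, -, hj⟩ := Finset.exists_ne_zero_of_sum_ne_zero hpos'.ne'
    refine Finset.sum_lt_sum (fun i _ => ?_) ⟨j, mem_univ _, ?_⟩
    · by_cases hi : hB.eigenvalues i ≤ t
      · simp [hvB i hi]
      · exact mul_le_mul_of_nonneg_right (not_le.1 hi).le (Complex.normSq_nonneg _)
    · have hjt : ¬ hB.eigenvalues j ≤ t := fun h => hj (by simp [hvB j h])
      exact mul_lt_mul_of_pos_right (not_le.1 hjt) ((Complex.normSq_nonneg _).lt_of_ne' hj)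
  rw [← Finset.mul_sum, unit A v] at upper
  rw [← Finset.mul_sum, unit B v] at lower
  linarith

theorem svESD_le_add {k n : ℕ} (A B : Matrix (Fin k) (Fin n) ℂ) (T : Finset (Fin k))
    (hT : ∀ i ∉ T, A i = B i) (x : ℝ) : svESD A x ≤ svESD B x + T.card / k := by
  unfold svESD
  rw [← add_div]
  refine div_le_div_of_nonneg_right ?_ (Nat.cast_nonneg k)
  by_cases hx : 0 ≤ x
  · simp only [Real.sqrt_le_iff, hx, true_and]
    exact_mod_cast card_gram_eigenvalues_le A B T hT (x ^ 2)
  · simp only [Real.sqrt_le_iff, hx, false_and]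
    simp

theorem svESD_nonneg {k n : ℕ} (A : Matrix (Fin k) (Fin n) ℂ) (x : ℝ) : 0 ≤ svESD A x := by
  unfold svESD
  positivity

theorem svESD_le_one {k n : ℕ} (A : Matrix (Fin k) (Fin n) ℂ) (x : ℝ) : svESD A x ≤ 1 := by
  refine div_le_one_of_le₀ ?_ (Nat.cast_nonneg k)
  exact_mod_cast (Finset.card_le_univ _).trans_eq (Fintype.card_fin k)

theorem svESD_monotone {k n : ℕ} (A : Matrix (Fin k) (Fin n) ℂ) : Monotone (svESD A) := by
  intro x y hxy
  refine div_le_div_of_nonneg_right ?_ (Nat.cast_nonneg k)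
  exact_mod_cast Finset.card_le_card
    (Finset.monotone_filter_right _ fun i _ hi => le_trans hi hxy)

theorem finite_range_svESD {k n : ℕ} (A : Matrix (Fin k) (Fin n) ℂ) :
    (Set.range (svESD A)).Finite := by
  refine ((Set.finite_Iic k).image fun c : ℕ => (c : ℝ) / k).subset ?_
  rintro _ ⟨x, rfl⟩
  exact ⟨_, (Finset.card_le_univ _).trans_eq (Fintype.card_fin k), rfl⟩

theorem svESD_rsub_swap_le {n k : ℕ} (hk : k ≤ n) (M : Matrix (Fin n) (Fin n) ℂ)
    (p : Equiv.Perm (Fin n)) (a b : Fin n) (x : ℝ) :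
    |svESD (rsub hk M p) x - svESD (rsub hk M (Equiv.swap a b * p)) x| ≤ 2 / k := by
  set T : Finset (Fin k) := univ.filter fun i => p (Fin.castLE hk i) ∈ ({a, b} : Finset (Fin n))
  have hcard : T.card ≤ 2 := by
    refine (Finset.card_le_card_of_injOn (fun i => p (Fin.castLE hk i)) (t := {a, b}) ?_ ?_).trans
      Finset.card_le_two
    · intro i hi
      exact (Finset.mem_filter.1 hi).2
    · exact (p.injective.comp (Fin.castLE_injective hk)).injOn
  have hT : ∀ i ∉ T, rsub hk M p i = rsub hk M (Equiv.swap a b * p) i := by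
    intro i hi
    simp only [T, Finset.mem_filter, Finset.mem_univ, true_and, Finset.mem_insert,
      Finset.mem_singleton, not_or] at hi
    ext j
    simp [rsub, Equiv.swap_apply_of_ne_of_ne hi.1 hi.2]
  have hc : (T.card : ℝ) / k ≤ 2 / k :=
    div_le_div_of_nonneg_right (by exact_mod_cast hcard) (Nat.cast_nonneg k)
  have h1 := svESD_le_add _ _ T hT x
  have h2 := svESD_le_add _ _ T (fun i hi => (hT i hi).symm) x
  rw [abs_le]
  constructor <;> linarith

/-- A finite form of Hoeffding's lemma. -/
theorem sum_exp_le_of_abs_sub_le {ι : Type*} [Fintype ι] [Nonempty ι] (m : ι → ℝ) (c : ℝ)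
    (hm : ∀ a b, |m a - m b| ≤ c) :
    ∑ a, Real.exp (m a) ≤
      Fintype.card ι * Real.exp ((∑ a, m a) / Fintype.card ι + c ^ 2 / 2) := by
  set N : ℝ := (Fintype.card ι : ℝ) with hN
  have hN0 : 0 < N := by rw [hN]; exact_mod_cast Fintype.card_pos
  have jensen : N * Real.exp (-((∑ a, m a) / N)) ≤ ∑ b, Real.exp (-m b) := by
    have := convexOn_exp.map_sum_le (t := (univ : Finset ι)) (w := fun _ => N⁻¹)
      (p := fun b => -m b) (fun _ _ => by positivity)
      (by rw [Finset.sum_const, Finset.card_univ, nsmul_eq_mul, ← hN, mul_inv_cancel₀ hN0.ne'])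
      (fun _ _ => Set.mem_univ _)
    simp only [smul_eq_mul, ← Finset.mul_sum, Finset.sum_neg_distrib] at this
    rw [show -((∑ a, m a) / N) = N⁻¹ * -∑ a, m a by ring]
    calc N * Real.exp (N⁻¹ * -∑ a, m a) ≤ N * (N⁻¹ * ∑ b, Real.exp (-m b)) := by gcongr
      _ = _ := by field_simp
  have double : (∑ a, Real.exp (m a)) * ∑ b, Real.exp (-m b) ≤ N * N * Real.exp (c ^ 2 / 2) := by
    have e1 : (∑ a, Real.exp (m a)) * ∑ b, Real.exp (-m b) =
        ∑ a, ∑ b, Real.exp (m a - m b) := by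
      rw [Finset.sum_mul_sum]
      simp only [← Real.exp_add, sub_eq_add_neg]
    have e2 : ∑ a, ∑ b, Real.exp (m a - m b) = ∑ a, ∑ b, Real.exp (-(m a - m b)) := by
      rw [Finset.sum_comm]
      simp only [neg_sub]
    have e3 : ∑ a, ∑ b, Real.exp (m a - m b) = ∑ a, ∑ b, Real.cosh (m a - m b) := by
      simp only [Real.cosh_eq, ← Finset.sum_div, Finset.sum_add_distrib]
      rw [← e2]
      ring
    rw [e1, e3]
    calc ∑ a, ∑ b, Real.cosh (m a - m b) ≤ ∑ _a : ι, ∑ _b : ι, Real.exp (c ^ 2 / 2) := by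
          refine Finset.sum_le_sum fun a _ => Finset.sum_le_sum fun b _ => ?_
          refine (Real.cosh_le_exp_half_sq _).trans (Real.exp_le_exp.2 ?_)
          have := sq_le_sq' (abs_le.1 (hm a b)).1 (abs_le.1 (hm a b)).2
          linarith
      _ = _ := by simp [← hN, mul_assoc]
  have hS : 0 ≤ ∑ a, Real.exp (m a) := Finset.sum_nonneg fun _ _ => (Real.exp_pos _).le
  have h := (mul_le_mul_of_nonneg_left jensen hS).trans double
  rw [Real.exp_neg] at h
  rw [Real.exp_add]
  have hE := Real.exp_pos ((∑ a, m a) / N)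
  have h' : (∑ a, Real.exp (m a)) * N ≤
      (N * (Real.exp ((∑ a, m a) / N) * Real.exp (c ^ 2 / 2))) * N := by
    calc (∑ a, Real.exp (m a)) * N
        = ((∑ a, Real.exp (m a)) * (N * (Real.exp ((∑ a, m a) / N))⁻¹)) *
          Real.exp ((∑ a, m a) / N) := by field_simp
      _ ≤ (N * N * Real.exp (c ^ 2 / 2)) * Real.exp ((∑ a, m a) / N) := by gcongr
      _ = _ := by ring
  exact le_of_mul_le_mul_right h' hN0

theorem decomposeFin_symm_swap_mul {n : ℕ} (x : Fin (n + 1)) (e : Equiv.Perm (Fin n))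
    (a b : Fin n) :
    Equiv.Perm.decomposeFin.symm (x, Equiv.swap a b * e) =
      Equiv.swap (Equiv.swap 0 x a.succ) (Equiv.swap 0 x b.succ) *
        Equiv.Perm.decomposeFin.symm (x, e) := by
  ext i : 1
  rw [Equiv.Perm.mul_apply]
  refine Fin.cases ?_ (fun i => ?_) i
  · rw [Equiv.Perm.decomposeFin_symm_apply_zero, Equiv.Perm.decomposeFin_symm_apply_zero,
      Equiv.swap_apply_of_ne_of_ne]
    · intro h
      have h' := congrArg (Equiv.swap 0 x) h
      simp at h'
      exact Fin.succ_ne_zero _ h'.symm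
    · intro h
      have h' := congrArg (Equiv.swap 0 x) h
      simp at h'
      exact Fin.succ_ne_zero _ h'.symm
  · rw [Equiv.Perm.decomposeFin_symm_apply_succ, Equiv.Perm.decomposeFin_symm_apply_succ,
      ← (Equiv.swap 0 x).injective.map_swap, Equiv.Perm.mul_apply,
      (Fin.succ_injective n).map_swap]

theorem sum_decomposeFin_symm {n : ℕ} (f : Equiv.Perm (Fin (n + 1)) → ℝ) (x : Fin (n + 1)) :
    ∑ e, f (Equiv.Perm.decomposeFin.symm (x, e)) = ∑ p with p 0 = x, f p := by
  refine Finset.sum_bij (fun e _ => Equiv.Perm.decomposeFin.symm (x, e)) ?_ ?_ ?_ ?_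
  · simp
  · intro e _ e' _ h
    simpa using h
  · intro p hp
    obtain ⟨⟨y, e⟩, rfl⟩ := Equiv.Perm.decomposeFin.symm.surjective p
    simp only [Finset.mem_filter, Equiv.Perm.decomposeFin_symm_apply_zero] at hp
    exact ⟨e, mem_univ _, by rw [hp.2]⟩
  · simp

theorem sum_decomposeFin_symm_eq_sum_swap {n : ℕ} (f : Equiv.Perm (Fin (n + 1)) → ℝ)
    (x y : Fin (n + 1)) :
    ∑ e, f (Equiv.Perm.decomposeFin.symm (y, e)) =
      ∑ e, f (Equiv.swap x y * Equiv.Perm.decomposeFin.symm (x, e)) := by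
  rw [sum_decomposeFin_symm, sum_decomposeFin_symm (fun p => f (Equiv.swap x y * p))]
  refine Finset.sum_bij (fun p _ => Equiv.swap x y * p) ?_ ?_ ?_ ?_
  · simp +contextual
  · simp
  · intro p hp
    refine ⟨Equiv.swap x y * p, ?_, ?_⟩
    · simp only [Finset.mem_filter, Finset.mem_univ, true_and] at hp ⊢
      simp [hp]
    · simp
  · simp

/-- Exponential moment bound for functions of the first `k` values of a uniformly random
permutation that vary by at most `c` under transpositions of the values. -/
theorem sum_perm_exp_le_s12 (c : ℝ) : ∀ (n k : ℕ) (f : Equiv.Perm (Fin n) → ℝ),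
    (∀ p a b, |f p - f (Equiv.swap a b * p)| ≤ c) →
    (∀ p q : Equiv.Perm (Fin n), (∀ i : Fin n, i.val < k → p i = q i) → f p = f q) →
    ∑ p, Real.exp (f p) ≤ (n.factorial : ℝ) *
      Real.exp ((∑ p, f p) / n.factorial + k * (c ^ 2 / 2)) := by
  intro n
  induction n with
  | zero =>
    intro k f _ _
    simp only [Finset.univ_unique, Finset.sum_singleton, Nat.factorial_zero, Nat.cast_one, one_mul,
      div_one]
    refine Real.exp_le_exp.2 (le_add_of_nonneg_right (by positivity))
  | succ n ih =>
    intro k f hf hdep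
    cases k with
    | zero =>
      have hconst : ∀ p, f p = f 1 := fun p => hdep p 1 fun i hi => absurd hi (Nat.not_lt_zero _)
      have hn : ((n + 1).factorial : ℝ) ≠ 0 := by positivity
      simp only [hconst, Finset.sum_const, Finset.card_univ, Fintype.card_perm, Fintype.card_fin,
        nsmul_eq_mul, Nat.cast_zero, zero_mul, add_zero, mul_div_cancel_left₀ _ hn]
      rfl
    | succ k =>
      set g : Fin (n + 1) → Equiv.Perm (Fin n) → ℝ :=
        fun x e => f (Equiv.Perm.decomposeFin.symm (x, e)) with hg
      have hsum : ∀ h : Equiv.Perm (Fin (n + 1)) → ℝ,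
          ∑ p, h p = ∑ x, ∑ e, h (Equiv.Perm.decomposeFin.symm (x, e)) := by
        intro h
        rw [← Equiv.sum_comp Equiv.Perm.decomposeFin.symm h, Fintype.sum_prod_type]
      have hn : (0 : ℝ) < n.factorial := by positivity
      set m : Fin (n + 1) → ℝ := fun x => (∑ e, g x e) / n.factorial with hm
      have hstep : ∀ x, ∑ e, Real.exp (g x e) ≤ (n.factorial : ℝ) *
          Real.exp (m x + k * (c ^ 2 / 2)) := by
        intro x
        refine ih k (g x) (fun p a b => ?_) (fun p q hpq => hdep _ _ fun i hi => ?_)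
        · simp only [hg]
          rw [decomposeFin_symm_swap_mul]
          exact hf _ _ _
        · revert hi
          refine Fin.cases (fun _ => ?_) (fun i hi => ?_) i
          · simp
          · rw [Fin.val_succ] at hi
            simp [hpq i (by omega)]
      have hmdiff : ∀ x y, |m x - m y| ≤ c := by
        intro x y
        simp only [hm, hg]
        rw [sum_decomposeFin_symm_eq_sum_swap f x y, ← sub_div, ← Finset.sum_sub_distrib, abs_div,
          abs_of_pos hn, div_le_iff₀ hn]
        refine (Finset.abs_sum_le_sum_abs _ _).trans ?_
        refine (Finset.sum_le_card_nsmul _ _ c fun e _ => hf _ _ _).trans_eq ?_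
        simp [Finset.card_univ, Fintype.card_perm, mul_comm]
      have hH := sum_exp_le_of_abs_sub_le m c hmdiff
      rw [Fintype.card_fin] at hH
      have hmean : (∑ x, m x) / ((n + 1 : ℕ) : ℝ) = (∑ p, f p) / (n + 1).factorial := by
        rw [hsum f, Nat.factorial_succ, Nat.cast_mul, mul_comm ((n + 1 : ℕ) : ℝ), ← div_div]
        simp only [hm, hg, Finset.sum_div]
      rw [hmean] at hH
      calc ∑ p, Real.exp (f p) = ∑ x, ∑ e, Real.exp (g x e) := hsum _
        _ ≤ ∑ x, (n.factorial : ℝ) * Real.exp (m x + k * (c ^ 2 / 2)) :=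
          Finset.sum_le_sum fun x _ => hstep x
        _ = (n.factorial * Real.exp (k * (c ^ 2 / 2))) * ∑ x, Real.exp (m x) := by
          rw [Finset.mul_sum]
          refine Finset.sum_congr rfl fun x _ => ?_
          rw [Real.exp_add]
          ring
        _ ≤ (n.factorial * Real.exp (k * (c ^ 2 / 2))) * (((n + 1 : ℕ) : ℝ) *
            Real.exp ((∑ p, f p) / (n + 1).factorial + c ^ 2 / 2)) := by gcongr
        _ = _ := by
          rw [Nat.factorial_succ, Nat.cast_mul, Nat.cast_succ k, add_mul, one_mul, ← add_assoc,
            add_right_comm, Real.exp_add _ (k * (c ^ 2 / 2))]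
          ring

/-- One-sided tail bound for functions of the first `k` values of a random permutation. -/
theorem card_perm_tail_le {n k : ℕ} (hk0 : 0 < k) (f : Equiv.Perm (Fin n) → ℝ)
    (hf : ∀ p a b, |f p - f (Equiv.swap a b * p)| ≤ 2 / k)
    (hdep : ∀ p q : Equiv.Perm (Fin n), (∀ i : Fin n, i.val < k → p i = q i) → f p = f q)
    (r : ℝ) :
    ((univ.filter fun p => r ≤ f p - (∑ q, f q) / n.factorial).card : ℝ) ≤
      n.factorial * (Real.exp (1 / 4) * Real.exp (-(r * Real.sqrt (k / 8)))) := by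
  set s := Real.sqrt (k / 8) with hs
  have hs0 : 0 ≤ s := Real.sqrt_nonneg _
  have hs2 : s ^ 2 = k / 8 := Real.sq_sqrt (by positivity)
  have hk' : (0 : ℝ) < k := by exact_mod_cast hk0
  set μ := (∑ q, f q) / n.factorial with hμ
  have key := sum_perm_exp_le_s12 (s * (2 / k)) n k (fun p => s * f p)
    (fun p a b => by
      rw [← mul_sub, abs_mul, abs_of_nonneg hs0]
      exact mul_le_mul_of_nonneg_left (hf p a b) hs0)
    (fun p q h => by rw [hdep p q h])
  have hexp : (∑ p, s * f p) / n.factorial + k * ((s * (2 / k)) ^ 2 / 2) = s * μ + 1 / 4 := by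
    have hvar : (k : ℝ) * (k / 8 * (2 / k) ^ 2 / 2) = 1 / 4 := by
      field_simp
      norm_num
    rw [mul_pow, hs2, hvar, ← Finset.mul_sum, mul_div_assoc]
  rw [hexp] at key
  have markov : ((univ.filter fun p => r ≤ f p - μ).card : ℝ) * Real.exp (s * (r + μ)) ≤
      ∑ p, Real.exp (s * f p) := by
    rw [← nsmul_eq_mul]
    refine (Finset.card_nsmul_le_sum _ (fun p => Real.exp (s * f p)) _ fun p hp => ?_).trans
      (Finset.sum_le_sum_of_subset_of_nonneg (Finset.filter_subset _ _)
        fun _ _ _ => (Real.exp_pos _).le)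
    have := (Finset.mem_filter.1 hp).2
    exact Real.exp_le_exp.2 (mul_le_mul_of_nonneg_left (by linarith) hs0)
  have h := markov.trans key
  rw [← le_div_iff₀ (Real.exp_pos _), mul_div_assoc, ← Real.exp_sub] at h
  rw [← Real.exp_add]
  rwa [show s * μ + 1 / 4 - s * (r + μ) = 1 / 4 + -(r * s) by ring] at h

/-- Passage from pointwise tail bounds to a uniform bound for a finite family of monotone
functions with values in `[0, 1]`, by discretizing at `l + 1` quantiles. -/
theorem card_sup_deviation_le {P : Type*} [Fintype P] (G : P → ℝ → ℝ) (F : ℝ → ℝ)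
    (hmono : ∀ p, Monotone (G p)) (hfin : ∀ p, (Set.range (G p)).Finite)
    (hF0 : ∀ x, 0 ≤ F x) (hF1 : ∀ x, F x ≤ 1)
    (hF : ∃ Φ : (P → ℝ) → ℝ, ∀ x, F x = Φ fun p => G p x)
    (l : ℕ) (hl : 0 < l) (s r δ : ℝ) (hs : 1 / (l : ℝ) ≤ s)
    (hup : ∀ x, ((univ.filter fun p => r ≤ G p x - F x).card : ℝ) ≤ δ)
    (hlo : ∀ x, ((univ.filter fun p => r ≤ F x - G p x).card : ℝ) ≤ δ) :
    ((univ.filter fun p => s + r ≤ ⨆ x, |G p x - F x|).card : ℝ) ≤ (l + 1) * (2 * δ) := by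
  obtain ⟨Φ, hΦ⟩ := hF
  have hl' : (0 : ℝ) < l := by exact_mod_cast hl
  set V : ℝ → P → ℝ := fun x p => G p x with hV
  have hVmono : Monotone V := fun x y h p => hmono p h
  have hVfin : (Set.range V).Finite :=
    (Set.Finite.pi' hfin).subset (by rintro _ ⟨x, rfl⟩ p; exact ⟨x, rfl⟩)
  have ha : ∀ j : ℕ, ∃ a, ∀ x, F x < j / l → V x ≤ V a ∧ F a < j / l := by
    intro j
    by_cases hne : {x | F x < (j : ℝ) / l}.Nonempty
    · obtain ⟨a, ha, hmax⟩ := Set.Finite.exists_maximalFor' V _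
        (hVfin.subset (Set.image_subset_range _ _)) hne
      refine ⟨a, fun x hx => ⟨?_, ha⟩⟩
      rcases le_total x a with h | h
      · exact hVmono h
      · exact hmax hx (hVmono h)
    · exact ⟨0, fun x hx => absurd ⟨x, hx⟩ hne⟩
  have hb : ∀ j : ℕ, ∃ b, ∀ x, (j : ℝ) / l ≤ F x → V b ≤ V x ∧ (j : ℝ) / l ≤ F b := by
    intro j
    by_cases hne : {x | (j : ℝ) / l ≤ F x}.Nonempty
    · obtain ⟨b, hb, hmin⟩ := Set.Finite.exists_minimalFor' V _
        (hVfin.subset (Set.image_subset_range _ _)) hne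
      refine ⟨b, fun x hx => ⟨?_, hb⟩⟩
      rcases le_total b x with h | h
      · exact hVmono h
      · exact hmin hx (hVmono h)
    · exact ⟨0, fun x hx => absurd ⟨x, hx⟩ hne⟩
  choose a ha using ha
  choose b hb using hb
  have hsub : (univ.filter fun p => s + r ≤ ⨆ x, |G p x - F x|) ⊆
      (Finset.range (l + 1)).biUnion fun j =>
        (univ.filter fun p => r ≤ G p (a (j + 1)) - F (a (j + 1))) ∪
          (univ.filter fun p => r ≤ F (b j) - G p (b j)) := by
    intro p hp
    have hp := (Finset.mem_filter.1 hp).2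
    have hfin' : (Set.range fun x => |G p x - F x|).Finite := by
      refine (hVfin.image fun v => |v p - Φ v|).subset ?_
      rintro _ ⟨x, rfl⟩
      exact ⟨V x, ⟨x, rfl⟩, by simp only [hV, hΦ]⟩
    obtain ⟨x, hx⟩ := Set.Nonempty.csSup_mem (Set.range_nonempty _) hfin'
    have hx : s + r ≤ |G p x - F x| := hp.trans_eq hx.symm
    have hFl : 0 ≤ F x * l := mul_nonneg (hF0 x) hl'.le
    set j := ⌊F x * l⌋₊ with hj
    have hj1 : (j : ℝ) / l ≤ F x := by
      rw [div_le_iff₀ hl']; exact Nat.floor_le hFl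
    have hj2 : F x < ((j + 1 : ℕ) : ℝ) / l := by
      rw [lt_div_iff₀ hl', Nat.cast_succ]; exact Nat.lt_floor_add_one _
    have hjl : j ≤ l := by
      have : (j : ℝ) ≤ l := (Nat.floor_le hFl).trans (by nlinarith [hF1 x])
      exact_mod_cast this
    have hstep : ((j + 1 : ℕ) : ℝ) / l = j / l + 1 / l := by rw [Nat.cast_succ, add_div]
    simp only [Finset.mem_biUnion, Finset.mem_range, Finset.mem_union, Finset.mem_filter,
      Finset.mem_univ, true_and]
    refine ⟨j, by omega, ?_⟩
    rcases le_abs.1 hx with h | h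
    · left
      obtain ⟨h1, h2⟩ := ha (j + 1) x hj2
      have h3 : G p x ≤ G p (a (j + 1)) := h1 p
      linarith
    · right
      obtain ⟨h1, h2⟩ := hb j x hj1
      have h3 : G p (b j) ≤ G p x := h1 p
      linarith
  have hcard := (Finset.card_le_card hsub).trans Finset.card_biUnion_le
  calc _ ≤ ((∑ j ∈ Finset.range (l + 1),
        ((univ.filter fun p => r ≤ G p (a (j + 1)) - F (a (j + 1))) ∪
          (univ.filter fun p => r ≤ F (b j) - G p (b j))).card : ℕ) : ℝ) := by
        exact_mod_cast hcard
    _ ≤ ∑ _j ∈ Finset.range (l + 1), 2 * δ := by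
        rw [Nat.cast_sum]
        refine Finset.sum_le_sum fun j _ => ?_
        refine (Nat.cast_le.2 (Finset.card_union_le _ _)).trans ?_
        rw [Nat.cast_add]
        linarith [hup (a (j + 1)), hlo (b j)]
    _ = _ := by simp

/-- Concentration in sup norm for the singular value distribution of a random `k × n`
submatrix of an arbitrary square matrix `M`:
`P(‖F_A - F‖_∞ ≥ k^{-1/2} + r) ≤ 12 √k exp(-r √(k/8))`. -/
theorem svESD_sup_concentration {n k : ℕ} (hk0 : 0 < k) (hk : k ≤ n)
    (M : Matrix (Fin n) (Fin n) ℂ) (r : ℝ) (hr : 0 ≤ r) :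
    ((Finset.univ.filter fun p : Equiv.Perm (Fin n) =>
        1 / Real.sqrt k + r ≤ ⨆ x : ℝ, |svESD (rsub hk M p) x - meanSvESD hk M x|).card : ℝ) /
        Fintype.card (Equiv.Perm (Fin n)) ≤
      12 * Real.sqrt k * Real.exp (-(r * Real.sqrt (k / 8))) := by
  have hk' : (1 : ℝ) ≤ k := by exact_mod_cast hk0
  have hsqrt : 1 ≤ Real.sqrt k := Real.one_le_sqrt.2 hk'
  have hcardP : Fintype.card (Equiv.Perm (Fin n)) = n.factorial := by
    rw [Fintype.card_perm, Fintype.card_fin]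
  have hN : (0 : ℝ) < n.factorial := by positivity
  have hdep : ∀ x, ∀ p q : Equiv.Perm (Fin n), (∀ i : Fin n, i.val < k → p i = q i) →
      svESD (rsub hk M p) x = svESD (rsub hk M q) x := by
    intro x p q h
    have : rsub hk M p = rsub hk M q := by
      ext i j
      simp [rsub, h (Fin.castLE hk i) i.isLt]
    rw [this]
  set l := ⌈Real.sqrt k⌉₊ with hl
  have hl0 : 0 < l := Nat.ceil_pos.2 (by linarith)
  have hl1 : Real.sqrt k ≤ l := Nat.le_ceil _
  have hl2 : (l : ℝ) < Real.sqrt k + 1 := Nat.ceil_lt_add_one (by linarith)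
  have main := card_sup_deviation_le (fun p => svESD (rsub hk M p)) (meanSvESD hk M)
    (fun p => svESD_monotone _) (fun p => finite_range_svESD _)
    (fun x => div_nonneg (Finset.sum_nonneg fun p _ => svESD_nonneg _ _) (Nat.cast_nonneg _))
    (fun x => div_le_one_of_le₀
      ((Finset.sum_le_card_nsmul _ _ 1 fun p _ => svESD_le_one _ _).trans_eq
        (by rw [nsmul_one, Finset.card_univ])) (Nat.cast_nonneg _))
    ⟨fun v => (∑ p, v p) / Fintype.card (Equiv.Perm (Fin n)), fun x => rfl⟩
    l hl0 (1 / Real.sqrt k) r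
    (n.factorial * (Real.exp (1 / 4) * Real.exp (-(r * Real.sqrt (k / 8)))))
    (one_div_le_one_div_of_le (by linarith) hl1)
    (fun x => by
      have := card_perm_tail_le hk0 (fun p => svESD (rsub hk M p) x)
        (fun p a b => svESD_rsub_swap_le hk M p a b x) (hdep x) r
      simpa only [meanSvESD, hcardP] using this)
    (fun x => by
      have := card_perm_tail_le hk0 (fun p => -svESD (rsub hk M p) x)
        (fun p a b => by
          rw [← neg_sub', abs_neg]
          exact svESD_rsub_swap_le hk M p a b x)
        (fun p q h => by rw [hdep x p q h]) r
      simp only [Finset.sum_neg_distrib, neg_div, sub_neg_eq_add, neg_add_eq_sub] at this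
      simpa only [meanSvESD, hcardP] using this)
  have hexp : Real.exp (1 / 4) ≤ 2 := by
    have h := Real.exp_bound_div_one_sub_of_interval (x := 1 / 4) (by norm_num) (by norm_num)
    exact h.trans (by norm_num)
  rw [hcardP, div_le_iff₀ hN]
  refine main.trans ?_
  have hE := Real.exp_pos (-(r * Real.sqrt (k / 8)))
  calc (l + 1 : ℝ) * (2 * (n.factorial *
        (Real.exp (1 / 4) * Real.exp (-(r * Real.sqrt (k / 8))))))
      ≤ (3 * Real.sqrt k) * (2 * (n.factorial *
        (2 * Real.exp (-(r * Real.sqrt (k / 8)))))) := by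
        gcongr
        linarith
    _ = _ := by ring
end

section
/- Let M be the n×n diagonal matrix with n/2 diagonal entries equal to 1 and the rest 0 (n even). Let A be a uniformly random k×k principal submatrix of M and F(x) = E[F_A(x)]. Then there is a universal constant c > 0 such that E||F_A − F||_∞ ≥ c·k^{−1/2} for all even n ≥ 2k and all k ≥ 1. -/
open scoped Classical
open Matrix Finset

/-- The `n × n` diagonal matrix with `n / 2` diagonal entries equal to `1` and the rest `0`. -/
noncomputable def halfDiag (n : ℕ) : Matrix (Fin n) (Fin n) ℂ :=
  Matrix.diagonal fun i => if (i : ℕ) < n / 2 then 1 else 0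

lemma halfDiag_isHermitian (n : ℕ) : (halfDiag n).IsHermitian := by
  rw [halfDiag, Matrix.isHermitian_diagonal_iff]
  intro i
  split <;> simp [_root_.IsSelfAdjoint]

section PermutationSums

variable {n : ℕ}

/-- The sum of the first `k` terms of `ε` rearranged by the permutation `p`. -/
noncomputable def permPartialSum (ε : Fin n → ℝ) (k : ℕ) (p : Equiv.Perm (Fin n)) : ℝ :=
  ∑ i : Fin n with i.val < k, ε (p i)

lemma permPartialSum_zero (ε : Fin n → ℝ) (p : Equiv.Perm (Fin n)) :
    permPartialSum ε 0 p = 0 := by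
  simp [permPartialSum]

lemma permPartialSum_succ (ε : Fin n → ℝ) {k : ℕ} (hk : k < n) (p : Equiv.Perm (Fin n)) :
    permPartialSum ε (k + 1) p = permPartialSum ε k p + ε (p ⟨k, hk⟩) := by
  have h : (univ.filter fun i : Fin n => i.val < k + 1)
      = insert ⟨k, hk⟩ (univ.filter fun i : Fin n => i.val < k) := by
    ext i
    simp only [mem_filter, mem_univ, true_and, mem_insert, Fin.ext_iff]
    omega
  rw [permPartialSum, h, sum_insert (by simp), add_comm, permPartialSum]

lemma permPartialSum_mul_swap (ε : Fin n → ℝ) {k : ℕ} {i j : Fin n} (hi : k ≤ i.val)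
    (hj : k ≤ j.val) (p : Equiv.Perm (Fin n)) :
    permPartialSum ε k (p * Equiv.swap i j) = permPartialSum ε k p := by
  refine sum_congr rfl fun l hl => ?_
  have hl : l.val < k := by simpa using hl
  rw [Equiv.Perm.mul_apply, Equiv.swap_apply_of_ne_of_ne] <;> rintro rfl <;> omega

/-- Exchangeability of the terms after the `k`-th one. -/
lemma sum_perm_next_mul (ε : Fin n → ℝ) (hε : ∑ i, ε i = 0) {k : ℕ} (hk : k < n) (h : ℝ → ℝ) :
    ∑ p : Equiv.Perm (Fin n), ε (p ⟨k, hk⟩) * h (permPartialSum ε k p) =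
      -(∑ p : Equiv.Perm (Fin n), permPartialSum ε k p * h (permPartialSum ε k p)) / (n - k) := by
  have hpos : (0 : ℝ) < n - k := sub_pos.2 (by exact_mod_cast hk)
  rw [eq_div_iff hpos.ne']
  have hswap : ∀ i : Fin n, k ≤ i.val →
      ∑ p : Equiv.Perm (Fin n), ε (p i) * h (permPartialSum ε k p) =
        ∑ p : Equiv.Perm (Fin n), ε (p ⟨k, hk⟩) * h (permPartialSum ε k p) := by
    intro i hi
    refine Fintype.sum_equiv (Equiv.mulRight (Equiv.swap i ⟨k, hk⟩)) _ _ fun p => ?_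
    simp [permPartialSum_mul_swap ε (j := ⟨k, hk⟩) hi le_rfl]
  have hcard : ((univ.filter fun i : Fin n => ¬ i.val < k).card : ℝ) = n - k := by
    have h1 := card_filter_add_card_filter_not (s := (univ : Finset (Fin n))) (fun i => i.val < k)
    have h2 : (univ.filter fun i : Fin n => i.val < k).card = k := by
      simp [Fin.card_filter_val_lt, hk.le]
    rw [h2, card_univ, Fintype.card_fin] at h1
    rw [← h1, Nat.cast_add, add_sub_cancel_left]
    congr!
  have hrest : ∀ p : Equiv.Perm (Fin n),
      ∑ i : Fin n with ¬ i.val < k, ε (p i) = -permPartialSum ε k p := by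
    intro p
    have h1 := sum_filter_add_sum_filter_not (univ : Finset (Fin n)) (fun i => i.val < k)
      (fun i => ε (p i))
    rw [Equiv.sum_comp p ε, hε] at h1
    rw [permPartialSum]; linarith
  calc _ = ∑ i : Fin n with ¬ i.val < k,
        ∑ p : Equiv.Perm (Fin n), ε (p i) * h (permPartialSum ε k p) := by
        rw [sum_congr rfl fun i hi => hswap i (by simpa using hi), sum_const, nsmul_eq_mul, hcard,
          mul_comm]
    _ = _ := by
        rw [sum_comm, ← sum_neg_distrib]
        refine sum_congr rfl fun p _ => ?_
        rw [← sum_mul, hrest, neg_mul]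

/-- The average over all permutations of the `j`-th power of the `k`-th partial sum. -/
noncomputable def permMoment (ε : Fin n → ℝ) (j k : ℕ) : ℝ :=
  (∑ p : Equiv.Perm (Fin n), permPartialSum ε k p ^ j) / Fintype.card (Equiv.Perm (Fin n))

lemma permMoment_next_mul (ε : Fin n → ℝ) (hε : ∑ i, ε i = 0) {k : ℕ} (hk : k < n) (j : ℕ) :
    (∑ p : Equiv.Perm (Fin n), ε (p ⟨k, hk⟩) * permPartialSum ε k p ^ j) /
      Fintype.card (Equiv.Perm (Fin n)) = -permMoment ε (j + 1) k / (n - k) := by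
  rw [sum_perm_next_mul ε hε hk (· ^ j), permMoment]
  simp only [pow_succ']
  ring

lemma permMoment_one (ε : Fin n → ℝ) (hε : ∑ i, ε i = 0) {k : ℕ} (hk : k ≤ n) :
    permMoment ε 1 k = 0 := by
  induction k with
  | zero => simp [permMoment, permPartialSum_zero]
  | succ k ih =>
    have h0 := permMoment_next_mul ε hε hk 0
    rw [zero_add, ih (by omega)] at h0
    have h1 : permMoment ε 1 (k + 1) = permMoment ε 1 k +
        (∑ p : Equiv.Perm (Fin n), ε (p ⟨k, hk⟩) * permPartialSum ε k p ^ 0) /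
          Fintype.card (Equiv.Perm (Fin n)) := by
      simp only [permMoment, ← add_div, ← sum_add_distrib]
      congr 1
      refine sum_congr rfl fun p _ => ?_
      rw [permPartialSum_succ ε hk]; ring
    rw [h1, h0, ih (by omega)]; simp

lemma permMoment_two_succ (ε : Fin n → ℝ) (hε : ∑ i, ε i = 0) (hsq : ∀ i, ε i ^ 2 = 1) {k : ℕ}
    (hk : k < n) :
    permMoment ε 2 (k + 1) = permMoment ε 2 k - 2 * (permMoment ε 2 k / (n - k)) + 1 := by
  have h1 := permMoment_next_mul ε hε hk 1
  have h : permMoment ε 2 (k + 1) = permMoment ε 2 k +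
      2 * ((∑ p : Equiv.Perm (Fin n), ε (p ⟨k, hk⟩) * permPartialSum ε k p ^ 1) /
          Fintype.card (Equiv.Perm (Fin n))) +
      (∑ p : Equiv.Perm (Fin n), (1 : ℝ)) / Fintype.card (Equiv.Perm (Fin n)) := by
    simp only [permMoment, ← mul_div_assoc, ← add_div, mul_sum, ← sum_add_distrib]
    congr 1
    refine sum_congr rfl fun p _ => ?_
    rw [permPartialSum_succ ε hk]
    linear_combination hsq (p ⟨k, hk⟩)
  have hone : (∑ p : Equiv.Perm (Fin n), (1 : ℝ)) / Fintype.card (Equiv.Perm (Fin n)) = 1 := by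
    rw [sum_const, card_univ, nsmul_eq_mul, mul_one]
    exact div_self (by exact_mod_cast Fintype.card_ne_zero)
  rw [h, h1, hone]; ring

lemma permMoment_four_succ (ε : Fin n → ℝ) (hε : ∑ i, ε i = 0) (hsq : ∀ i, ε i ^ 2 = 1) {k : ℕ}
    (hk : k < n) :
    permMoment ε 4 (k + 1) = permMoment ε 4 k - 4 * (permMoment ε 4 k / (n - k)) +
      6 * permMoment ε 2 k - 4 * (permMoment ε 2 k / (n - k)) + 1 := by
  have h1 := permMoment_next_mul ε hε hk 1
  have h3 := permMoment_next_mul ε hε hk 3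
  have h : permMoment ε 4 (k + 1) = permMoment ε 4 k +
      4 * ((∑ p : Equiv.Perm (Fin n), ε (p ⟨k, hk⟩) * permPartialSum ε k p ^ 3) /
          Fintype.card (Equiv.Perm (Fin n))) + 6 * permMoment ε 2 k +
      4 * ((∑ p : Equiv.Perm (Fin n), ε (p ⟨k, hk⟩) * permPartialSum ε k p ^ 1) /
          Fintype.card (Equiv.Perm (Fin n))) +
      (∑ p : Equiv.Perm (Fin n), (1 : ℝ)) / Fintype.card (Equiv.Perm (Fin n)) := by
    simp only [permMoment, ← mul_div_assoc, ← add_div, mul_sum, ← sum_add_distrib]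
    congr 1
    refine sum_congr rfl fun p _ => ?_
    rw [permPartialSum_succ ε hk]
    linear_combination (6 * permPartialSum ε k p ^ 2 + 4 * permPartialSum ε k p * ε (p ⟨k, hk⟩) +
      ε (p ⟨k, hk⟩) ^ 2 + 1) * hsq (p ⟨k, hk⟩)
  have hone : (∑ p : Equiv.Perm (Fin n), (1 : ℝ)) / Fintype.card (Equiv.Perm (Fin n)) = 1 := by
    rw [sum_const, card_univ, nsmul_eq_mul, mul_one]
    exact div_self (by exact_mod_cast Fintype.card_ne_zero)
  rw [h, h1, h3, hone]; ring

lemma permMoment_two (ε : Fin n → ℝ) (hε : ∑ i, ε i = 0) (hsq : ∀ i, ε i ^ 2 = 1) (hn : 2 ≤ n)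
    {k : ℕ} (hk : k ≤ n) : permMoment ε 2 k = k * (n - k) / (n - 1) := by
  induction k with
  | zero => simp [permMoment, permPartialSum_zero]
  | succ k ih =>
    have h1 : (n : ℝ) - k ≠ 0 := (sub_pos.2 (by exact_mod_cast hk)).ne'
    have h2 : (n : ℝ) - 1 ≠ 0 := (sub_pos.2 (by exact_mod_cast hn)).ne'
    rw [permMoment_two_succ ε hε hsq hk, ih (by omega)]
    push_cast
    field_simp
    ring

lemma permMoment_four_le (ε : Fin n → ℝ) (hε : ∑ i, ε i = 0) (hsq : ∀ i, ε i ^ 2 = 1)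
    (hn : 2 ≤ n) {k : ℕ} (hk : k ≤ n) : permMoment ε 4 k ≤ 3 * (k : ℝ) ^ 2 := by
  induction k with
  | zero => simp [permMoment, permPartialSum_zero]
  | succ k ih =>
    have hpos : (0 : ℝ) < n - k := sub_pos.2 (by exact_mod_cast hk)
    have hn1 : (0 : ℝ) < n - 1 := sub_pos.2 (by exact_mod_cast hn)
    have h4 : 0 ≤ permMoment ε 4 k / (n - k) := by
      refine div_nonneg (div_nonneg (sum_nonneg fun p _ => ?_) (by positivity)) hpos.le
      positivity
    have h2 : 0 ≤ permMoment ε 2 k / (n - k) := by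
      refine div_nonneg (div_nonneg (sum_nonneg fun p _ => ?_) (by positivity)) hpos.le
      positivity
    have h2le : permMoment ε 2 k ≤ k := by
      rw [permMoment_two ε hε hsq hn (by omega), div_le_iff₀ hn1]
      rcases Nat.eq_zero_or_pos k with rfl | hk1
      · simp
      · have : (1 : ℝ) ≤ k := by exact_mod_cast hk1
        gcongr
    rw [permMoment_four_succ ε hε hsq hk]
    push_cast
    nlinarith [ih (by omega)]

/-- The mean absolute value of a partial sum of a balanced sign sequence is of order `√k`. -/
lemma sqrt_le_mean_abs_permPartialSum (ε : Fin n → ℝ) (hε : ∑ i, ε i = 0)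
    (hsq : ∀ i, ε i ^ 2 = 1) {k : ℕ} (hk : 1 ≤ k) (hkn : 2 * k ≤ n) :
    5 / 32 * Real.sqrt k ≤ (∑ p : Equiv.Perm (Fin n), |permPartialSum ε k p|) /
      Fintype.card (Equiv.Perm (Fin n)) := by
  have hk' : (1 : ℝ) ≤ k := by exact_mod_cast hk
  have hkn' : 2 * (k : ℝ) ≤ n := by exact_mod_cast hkn
  set r := Real.sqrt k
  have hr0 : 0 < r := Real.sqrt_pos.2 (by linarith)
  have hrk : r ^ 2 = k := Real.sq_sqrt (by linarith)
  have hpt : ∀ s : ℝ, s ^ 2 / (2 * r) - s ^ 4 / (32 * r ^ 3) ≤ |s| := by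
    intro s
    obtain ⟨u, hu⟩ : ∃ u, |s| = u * (2 * r) := ⟨|s| / (2 * r), by field_simp⟩
    have hu0 : 0 ≤ u := by
      have : 0 ≤ u * (2 * r) := hu ▸ abs_nonneg s
      exact nonneg_of_mul_nonneg_left this (by linarith)
    have h2 : s ^ 2 = (u * (2 * r)) ^ 2 := by rw [← hu, sq_abs]
    have h4 : s ^ 4 = (u * (2 * r)) ^ 4 := by rw [← hu]; exact (Even.pow_abs (by decide) s).symm
    rw [h2, h4, hu]
    have e : (u * (2 * r)) ^ 2 / (2 * r) - (u * (2 * r)) ^ 4 / (32 * r ^ 3) =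
        (2 * r) * (u ^ 2 - u ^ 4 / 4) := by
      field_simp
      ring
    have h : u ^ 2 - u ^ 4 / 4 ≤ u := by
      have : 0 ≤ 1 - u + u ^ 3 / 4 := by
        nlinarith [mul_nonneg hu0 (sq_nonneg (u - 1)), sq_nonneg (u - 1)]
      nlinarith [mul_nonneg hu0 this]
    rw [e]
    nlinarith
  have hmean : permMoment ε 2 k / (2 * r) - permMoment ε 4 k / (32 * r ^ 3) ≤
      (∑ p : Equiv.Perm (Fin n), |permPartialSum ε k p|) /
        Fintype.card (Equiv.Perm (Fin n)) := by
    have := div_le_div_of_nonneg_right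
      (sum_le_sum fun p (_ : p ∈ (univ : Finset (Equiv.Perm (Fin n)))) =>
        hpt (permPartialSum ε k p))
      (Nat.cast_nonneg (α := ℝ) (Fintype.card (Equiv.Perm (Fin n))))
    refine le_trans (le_of_eq ?_) this
    rw [sum_sub_distrib, ← sum_div, ← sum_div, permMoment, permMoment]
    ring
  have h2 : r ^ 2 / 2 ≤ permMoment ε 2 k := by
    rw [permMoment_two ε hε hsq (by omega) (by omega), hrk, le_div_iff₀ (by linarith)]
    nlinarith
  have h4 : permMoment ε 4 k ≤ 3 * r ^ 4 := by
    have := permMoment_four_le ε hε hsq (by omega) (show k ≤ n by omega)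
    rwa [← hrk, ← pow_mul] at this
  refine le_trans ?_ hmean
  calc 5 / 32 * r = r ^ 2 / 2 / (2 * r) - 3 * r ^ 4 / (32 * r ^ 3) := by field_simp; ring
    _ ≤ _ := by gcongr

end PermutationSums

lemma esd_nonneg {m : Type*} [Fintype m] [DecidableEq m] {A : Matrix m m ℂ}
    (hA : A.IsHermitian) (x : ℝ) : 0 ≤ esd hA x := by
  unfold esd; positivity

lemma esd_le_one {m : Type*} [Fintype m] [DecidableEq m] {A : Matrix m m ℂ}
    (hA : A.IsHermitian) (x : ℝ) : esd hA x ≤ 1 :=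
  div_le_one_of_le₀ (by exact_mod_cast card_le_univ _) (by positivity)

lemma card_eigenvalues_le_of_eq_diagonal {m : Type*} [Fintype m] [DecidableEq m]
    {A : Matrix m m ℂ} (hA : A.IsHermitian) (d : m → ℝ)
    (hd : A = Matrix.diagonal fun i => (d i : ℂ)) (x : ℝ) :
    (Finset.univ.filter fun i => hA.eigenvalues i ≤ x).card =
      (Finset.univ.filter fun i => d i ≤ x).card := by
  have h1 := hA.roots_charpoly_eq_eigenvalues
  have h2 : A.charpoly.roots = Multiset.map (fun i => (d i : ℂ)) univ.val := by
    rw [hd, Matrix.charpoly_diagonal, Polynomial.roots_prod]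
    · simp
    · simp [Finset.prod_ne_zero_iff, Polynomial.X_sub_C_ne_zero]
  have h3 := congrArg (Multiset.countP fun z : ℂ => z.re ≤ x) (h1.symm.trans h2)
  simpa [Multiset.countP_map, Finset.card_def] using h3

lemma bddAbove_range_abs_fESD_sub {n k : ℕ} (hk : k ≤ n) (M : Matrix (Fin n) (Fin n) ℂ)
    (hM : M.IsHermitian) (p : Equiv.Perm (Fin n)) :
    BddAbove (Set.range fun x => |fESD hk M hM p x - meanESD hk M hM x|) := by
  refine ⟨1, ?_⟩
  rintro _ ⟨x, rfl⟩
  have h0 : 0 ≤ fESD hk M hM p x := esd_nonneg _ x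
  have h1 : fESD hk M hM p x ≤ 1 := esd_le_one _ x
  have h2 : 0 ≤ meanESD hk M hM x :=
    div_nonneg (sum_nonneg fun q _ => esd_nonneg _ x) (by positivity)
  have h3 : meanESD hk M hM x ≤ 1 := by
    refine div_le_one_of_le₀ ?_ (by positivity)
    refine (sum_le_card_nsmul univ _ 1 fun q _ => esd_le_one _ x).trans ?_
    simp
  exact abs_le.2 ⟨by linarith, by linarith⟩

/-- The sign sequence that is `1` on the first `n / 2` indices and `-1` on the others. -/
noncomputable def halfSign (n : ℕ) (i : Fin n) : ℝ := if i.val < n / 2 then 1 else -1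

lemma halfSign_sq (n : ℕ) (i : Fin n) : halfSign n i ^ 2 = 1 := by
  unfold halfSign; split <;> norm_num

lemma sum_halfSign {n : ℕ} (hn : Even n) : ∑ i, halfSign n i = 0 := by
  obtain ⟨m, rfl⟩ := hn
  have hm : (m + m) / 2 = m := by omega
  simp only [halfSign, hm]
  rw [Fin.sum_univ_add]
  simp

lemma fESD_halfDiag_zero {n k : ℕ} (hk0 : 1 ≤ k) (hk : k ≤ n) (p : Equiv.Perm (Fin n)) :
    fESD hk (halfDiag n) (halfDiag_isHermitian n) p 0 =
      1 / 2 - permPartialSum (halfSign n) k p / (2 * k) := by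
  have hk' : (k : ℝ) ≠ 0 := by positivity
  have hinj : Function.Injective fun a : Fin k => p (Fin.castLE hk a) :=
    p.injective.comp (Fin.castLE_injective hk)
  have hS : permPartialSum (halfSign n) k p = ∑ a : Fin k, halfSign n (p (Fin.castLE hk a)) := by
    symm
    refine sum_bij (fun a _ => Fin.castLE hk a) (fun a _ => by simp)
      (fun a _ b _ h => Fin.castLE_injective hk h)
      (fun i hi => ⟨⟨i.val, by simpa using hi⟩, mem_univ _, rfl⟩) (fun a _ => rfl)
  rw [fESD, esd, card_eigenvalues_le_of_eq_diagonal _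
    (fun a : Fin k => if (p (Fin.castLE hk a)).val < n / 2 then (1 : ℝ) else 0), hS,
    Fintype.card_fin, card_eq_sum_ones, sum_filter]
  · have h : ∀ a : Fin k, (if (if (p (Fin.castLE hk a)).val < n / 2 then (1 : ℝ) else 0) ≤ 0
        then (1 : ℝ) else 0) = 1 / 2 - halfSign n (p (Fin.castLE hk a)) / 2 := by
      intro a
      unfold halfSign
      split_ifs <;> norm_num at *
    push_cast
    rw [sum_congr rfl fun a _ => h a, sum_sub_distrib, ← sum_div, ← sum_div, sum_const, card_univ,
      Fintype.card_fin, nsmul_one]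
    field_simp
  · rw [halfDiag, Matrix.submatrix_diagonal _ _ hinj]
    congr 1
    ext a
    simp only [Function.comp]
    split <;> simp

lemma meanESD_halfDiag_zero {n k : ℕ} (hk0 : 1 ≤ k) (hk : k ≤ n) (hn : Even n) :
    meanESD hk (halfDiag n) (halfDiag_isHermitian n) 0 = 1 / 2 := by
  have h := permMoment_one (halfSign n) (sum_halfSign hn) hk
  have hc : (Fintype.card (Equiv.Perm (Fin n)) : ℝ) ≠ 0 := by
    exact_mod_cast Fintype.card_ne_zero
  simp only [permMoment, pow_one, div_eq_zero_iff, hc, or_false] at h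
  rw [meanESD, sum_congr rfl fun p _ => fESD_halfDiag_zero hk0 hk p, sum_sub_distrib,
    ← sum_div _ (permPartialSum (halfSign n) k), h, sum_const, card_univ, nsmul_eq_mul, zero_div,
    sub_zero, mul_div_cancel_left₀ _ hc]

/-- Lower bound: for the diagonal matrix with `n/2` ones on the diagonal, there is a
universal constant `c > 0` with `E ‖F_A - F‖_∞ ≥ c k^{-1/2}` for all even `n ≥ 2k`, `k ≥ 1`. -/
theorem esd_sup_expectation_lower_bound :
    ∃ c : ℝ, 0 < c ∧ ∀ (k n : ℕ) (hk0 : 1 ≤ k) (hk : k ≤ n),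
      Even n → 2 * k ≤ n →
        c / Real.sqrt k ≤
          (∑ p : Equiv.Perm (Fin n), ⨆ x : ℝ,
              |fESD hk (halfDiag n) (halfDiag_isHermitian n) p x -
                meanESD hk (halfDiag n) (halfDiag_isHermitian n) x|) /
            Fintype.card (Equiv.Perm (Fin n)) := by
  refine ⟨5 / 64, by norm_num, fun k n hk0 hk hn hkn => ?_⟩
  have hk' : (0 : ℝ) < k := by exact_mod_cast hk0
  have hr0 : 0 < Real.sqrt k := Real.sqrt_pos.2 hk'
  have hmain := sqrt_le_mean_abs_permPartialSum (halfSign n) (sum_halfSign hn) (halfSign_sq n)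
    hk0 hkn
  calc 5 / 64 / Real.sqrt k = 5 / 32 * Real.sqrt k / (2 * k) := by
        field_simp
        rw [Real.sq_sqrt hk'.le]
        ring
    _ ≤ (∑ p : Equiv.Perm (Fin n), |permPartialSum (halfSign n) k p|) /
          Fintype.card (Equiv.Perm (Fin n)) / (2 * k) := by gcongr
    _ = (∑ p : Equiv.Perm (Fin n), |permPartialSum (halfSign n) k p| / (2 * k)) /
          Fintype.card (Equiv.Perm (Fin n)) := by
        rw [← sum_div]; ring
    _ ≤ _ := by
        gcongr with p
        refine le_trans (le_of_eq ?_) (le_ciSup (bddAbove_range_abs_fESD_sub hk _ _ p) 0)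
        rw [fESD_halfDiag_zero hk0 hk, meanESD_halfDiag_zero hk0 hk hn, sub_sub_cancel_left,
          abs_neg, abs_div, abs_of_pos (show (0 : ℝ) < 2 * k by linarith)]
end
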